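/- (Key bilinear estimate for the nonlinearity.) Let 0 < α ≤ 1, 1 < r < 1 + α with conjugate exponent r′, and s > −1 − α + 2/r + α/(2r). Then there exist ε > 0 and C > 0 such that for all Schwartz functions u₁, u₂ on ℝ² (in variables (t,x)), ‖ ∂_x(u₁ u₂) ‖_{X̂^{s, −1/r′+2ε}_r} ≤ C ‖u₁‖_{X̂^{s, 1/r+ε}_r} ‖u₂‖_{X̂^{s, 1/r+ε}_r}. In particular ‖u u_x‖_{X̂^{s, −1/r′+2ε}_r} ≤ C ‖u‖²_{X̂^{s, 1/r+ε}_r}, which yields local well-posedness of the dispersion generalized Benjamin–Ono equation ∂_t u + |∂_x|^{1+α}∂_x u + u u_x = 0 in Ĥ^s_r(ℝ) by Picard iteration. -/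

import Mathlib

open MeasureTheory ENNReal Complex

/-- Dispersion relation of the dispersion generalized Benjamin–Ono equation. -/
noncomputable def omegaBO (α ξ : ℝ) : ℝ := -ξ * |ξ| ^ (1 + α)

/-- Spatial Fourier transform φ̂(ξ) = ∫ e^{-ixξ} φ(x) dx. -/
noncomputable def ft1 (φ : ℝ → ℂ) (ξ : ℝ) : ℂ :=
  ∫ x : ℝ, Complex.exp (-Complex.I * ((x * ξ : ℝ) : ℂ)) * φ x

/-- The free propagator W_α(t)φ(x) = (2π)⁻¹ ∫ e^{i(xξ + tω(ξ))} φ̂(ξ) dξ. -/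
noncomputable def Wprop (α : ℝ) (φ : ℝ → ℂ) (t x : ℝ) : ℂ :=
  ((2 * Real.pi)⁻¹ : ℝ) *
    ∫ ξ : ℝ, Complex.exp (Complex.I * ((x * ξ + t * omegaBO α ξ : ℝ) : ℂ)) * ft1 φ ξ

/-- Space–time Fourier transform û(ξ,τ) of u(t,x). -/
noncomputable def ft2 (u : ℝ × ℝ → ℂ) (ξ τ : ℝ) : ℂ :=
  ∫ p : ℝ × ℝ, Complex.exp (-Complex.I * ((p.1 * τ + p.2 * ξ : ℝ) : ℂ)) * u p

/-- The Japanese bracket ⟨ξ⟩ = (1+ξ²)^{1/2}. -/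
noncomputable def jap (ξ : ℝ) : ℝ := (1 + ξ ^ 2) ^ ((1 : ℝ) / 2)

/-- The Bourgain norm ‖u‖_{X̂^{s,b}_ρ} adapted to Fourier–Lebesgue spaces;
`ρd` is the dual exponent ρ′. -/
noncomputable def Xnorm (α s b : ℝ) (ρd : ℝ≥0∞) (u : ℝ × ℝ → ℂ) : ℝ≥0∞ :=
  eLpNorm (fun q : ℝ × ℝ =>
    jap q.1 ^ s * jap (q.2 - omegaBO α q.1) ^ b * ‖ft2 u q.1 q.2‖) ρd volume

/-- The Fourier–Lebesgue norm ‖φ‖_{Ĥ^s_r}; `ρd` is the dual exponent r′. -/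
noncomputable def FLnorm (s : ℝ) (ρd : ℝ≥0∞) (φ : ℝ → ℂ) : ℝ≥0∞ :=
  eLpNorm (fun ξ : ℝ => jap ξ ^ s * ‖ft1 φ ξ‖) ρd volume

/-- Mixed norm ‖F‖_{L^q_t L^p_x}. -/
noncomputable def mixedNorm (q p : ℝ≥0∞) (F : ℝ → ℝ → ℂ) : ℝ≥0∞ :=
  eLpNorm (fun t : ℝ => (eLpNorm (F t) p volume).toReal) q volume


open SchwartzMap FourierTransform in
/-- rescaled swap -/
noncomputable def gEquiv : WithLp 2 (ℝ × ℝ) ≃L[ℝ] ℝ × ℝ :=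
  ((WithLp.prodContinuousLinearEquiv 2 ℝ ℝ ℝ).trans (ContinuousLinearEquiv.prodComm ℝ ℝ ℝ)).trans
    (ContinuousLinearEquiv.smulLeft (Units.mk0 (2 * Real.pi) (by positivity)))

theorem gEquiv_apply (w : WithLp 2 (ℝ × ℝ)) :
    gEquiv w = (2 * Real.pi * w.snd, 2 * Real.pi * w.fst) := by
  rfl

noncomputable def vS (u : SchwartzMap (ℝ × ℝ) ℂ) : SchwartzMap (WithLp 2 (ℝ × ℝ)) ℂ :=
  SchwartzMap.compCLMOfContinuousLinearEquiv ℂ gEquiv u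

theorem vS_apply (u : SchwartzMap (ℝ × ℝ) ℂ) (w) :
    vS u w = u (2 * Real.pi * w.snd, 2 * Real.pi * w.fst) := rfl

open FourierTransform in
theorem ft2_eq (u : SchwartzMap (ℝ × ℝ) ℂ) (ξ τ : ℝ) :
    ft2 u ξ τ = (((2 * Real.pi) ^ 2 : ℝ) : ℂ) * (𝓕 (vS u)) (WithLp.toLp 2 (ξ, τ)) := by
  rw [SchwartzMap.fourier_coe, Real.fourier_eq']
  rw [← (WithLp.volume_preserving_toLp ℝ ℝ).integral_comp
    (MeasurableEquiv.toLp 2 (ℝ × ℝ)).measurableEmbedding]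
  unfold ft2
  have h := MeasureTheory.Measure.integral_comp_smul (volume : Measure (ℝ × ℝ))
    (fun p : ℝ × ℝ => Complex.exp (-Complex.I * ((p.1 * τ + p.2 * ξ : ℝ) : ℂ)) * u p) (2 * Real.pi)
  have h2 : ∫ p : ℝ × ℝ, Complex.exp (-Complex.I * ((p.1 * τ + p.2 * ξ : ℝ) : ℂ)) * u p =
    (((2 * Real.pi) ^ 2 : ℝ) : ℂ) * ∫ x : ℝ × ℝ, (fun p : ℝ × ℝ => Complex.exp (-Complex.I * ((p.1 * τ + p.2 * ξ : ℝ) : ℂ)) * u p) ((2 * Real.pi) • x) := by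
    rw [h]
    have : Module.finrank ℝ (ℝ × ℝ) = 2 := by simp
    rw [this, abs_of_pos (by positivity), Complex.real_smul, ← mul_assoc, ← Complex.ofReal_mul,
      mul_inv_cancel₀ (by positivity)]
    simp
  rw [h2]
  congr 1
  have hsw : MeasurePreserving (Prod.swap : ℝ × ℝ → ℝ × ℝ) volume volume :=
    MeasureTheory.Measure.measurePreserving_swap
  rw [← hsw.integral_comp MeasurableEquiv.prodComm.measurableEmbedding]
  congr 1
  ext x
  simp [vS_apply]
  congr 1
  congr 1
  ring

theorem ft2_meas (u : SchwartzMap (ℝ × ℝ) ℂ) : Measurable (fun q : ℝ × ℝ => ft2 u q.1 q.2) := by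
  simp_rw [ft2_eq]
  apply Measurable.const_mul
  exact (SchwartzMap.continuous _).measurable.comp (WithLp.measurable_toLp 2 _)

noncomputable def mulS {E : Type*} [NormedAddCommGroup E] [NormedSpace ℝ E] (u v : SchwartzMap E ℂ) : SchwartzMap E ℂ :=
  SchwartzMap.pairing (ContinuousLinearMap.mul ℂ ℂ) u v

open FourierTransform Convolution in
theorem fourier_mulS (u v : SchwartzMap (WithLp 2 (ℝ × ℝ)) ℂ) (x : WithLp 2 (ℝ × ℝ)) :
    (𝓕 (mulS u v)) x = ∫ y, (𝓕 u) y * (𝓕 v) (x - y) := by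
  have h1 := SchwartzMap.convolution_apply (ContinuousLinearMap.mul ℂ ℂ) (𝓕 u) (𝓕 v) x
  rw [MeasureTheory.convolution_def] at h1
  simp only [ContinuousLinearMap.mul_apply'] at h1
  rw [← h1]
  have hh : ∀ f : SchwartzMap (WithLp 2 (ℝ × ℝ)) ℂ, ∀ y, (𝓕 (𝓕 f)) y = f (-y) := by
    intro f y
    have : (𝓕⁻ (𝓕 f)) (-y) = f (-y) := by simp
    rw [← this, SchwartzMap.fourierInv_coe, SchwartzMap.fourier_coe, Real.fourierInv_eq_fourier_neg, neg_neg]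
  have h2 : (𝓕 (SchwartzMap.convolution (ContinuousLinearMap.mul ℂ ℂ) (𝓕 u) (𝓕 v))) = 𝓕 (𝓕 (mulS u v)) := by
    rw [SchwartzMap.fourier_convolution]
    ext y
    rw [hh]
    simp [mulS, hh]
  have h3 := congrArg (fun z => 𝓕⁻ z) h2
  simp only [FourierTransform.fourierInv_fourier_eq] at h3
  rw [h3]

theorem vS_mulS (u v : SchwartzMap (ℝ × ℝ) ℂ) : vS (mulS u v) = mulS (vS u) (vS v) := by
  ext w; rfl

open FourierTransform in
theorem ft2_deriv (w : SchwartzMap (ℝ × ℝ) ℂ) (ξ τ : ℝ) :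
    ft2 (fun p : ℝ × ℝ => deriv (fun x : ℝ => w (p.1, x)) p.2) ξ τ = Complex.I * ξ * ft2 w ξ τ := by
  set dw : SchwartzMap (ℝ × ℝ) ℂ := SchwartzMap.evalCLM ℝ (ℝ × ℝ) ℂ (0, 1) (SchwartzMap.fderivCLM ℝ (ℝ × ℝ) ℂ w) with hdw
  have e1 : (fun p : ℝ × ℝ => deriv (fun x : ℝ => w (p.1, x)) p.2) = dw := by
    ext p
    have hd : HasFDerivAt w (fderiv ℝ w p) (p.1, p.2) := (w.differentiable p).hasFDerivAt
    have hl : HasDerivAt (fun x : ℝ => (p.1, x)) ((0 : ℝ), (1 : ℝ)) p.2 :=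
      (hasDerivAt_const _ _).prodMk (hasDerivAt_id _)
    exact (hd.comp_hasDerivAt p.2 hl).deriv
  have e2 : LineDeriv.lineDerivOp (WithLp.toLp 2 ((1 : ℝ), (0 : ℝ))) (vS w) = (2 * Real.pi : ℂ) • vS dw := by
    ext y
    rw [SchwartzMap.lineDerivOp_apply_eq_fderiv]
    have hd : HasFDerivAt w (fderiv ℝ w (gEquiv y)) (gEquiv y) := (w.differentiable _).hasFDerivAt
    have := (hd.comp y gEquiv.hasFDerivAt).fderiv
    have h3 : fderiv ℝ (vS w) y = (fderiv ℝ w (gEquiv y)).comp (gEquiv : WithLp 2 (ℝ × ℝ) →L[ℝ] ℝ × ℝ) := this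
    rw [h3]
    have h4 : gEquiv (WithLp.toLp 2 ((1 : ℝ), (0 : ℝ))) = (2 * Real.pi) • ((0 : ℝ), (1 : ℝ)) := by
      rw [gEquiv_apply]; simp
    simp only [ContinuousLinearMap.comp_apply, ContinuousLinearEquiv.coe_coe, h4, map_smul]
    simp [vS_apply, hdw, ← gEquiv_apply]
  rw [e1, ft2_eq, ft2_eq]
  have e3 := SchwartzMap.fourier_lineDerivOp_eq (vS w) (WithLp.toLp 2 ((1 : ℝ), (0 : ℝ)))
  rw [e2] at e3
  have e4 := congrArg (fun f => f (WithLp.toLp 2 (ξ, τ))) e3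
  have htg : (fun y : WithLp 2 (ℝ × ℝ) => inner ℝ y (WithLp.toLp 2 ((1 : ℝ), (0 : ℝ)))).HasTemperateGrowth :=
    ((innerSL ℝ).flip _).hasTemperateGrowth
  simp only [FourierTransform.fourier_smul, smul_apply,
    SchwartzMap.smulLeftCLM_apply_apply htg] at e4
  simp at e4
  rw [mul_assoc (2 * (Real.pi : ℂ)) Complex.I] at e4
  have hpi : (2 * (Real.pi : ℂ)) ≠ 0 := by simp [Real.pi_ne_zero]
  have e5 := mul_left_cancel₀ hpi e4
  rw [e5]; ring

open FourierTransform in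
theorem ft2_conv (u v : SchwartzMap (ℝ × ℝ) ℂ) (ξ τ : ℝ) :
    ‖ft2 (mulS u v) ξ τ‖ₑ ≤ ∫⁻ q : ℝ × ℝ, ‖ft2 u q.1 q.2‖ₑ * ‖ft2 v (ξ - q.1) (τ - q.2)‖ₑ := by
  have h : ft2 (mulS u v) ξ τ = ((((2 * Real.pi) ^ 2)⁻¹ : ℝ) : ℂ) *
      ∫ q : ℝ × ℝ, ft2 u q.1 q.2 * ft2 v (ξ - q.1) (τ - q.2) := by
    rw [ft2_eq, vS_mulS, fourier_mulS,
      ← (WithLp.volume_preserving_toLp ℝ ℝ).integral_comp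
      (MeasurableEquiv.toLp 2 (ℝ × ℝ)).measurableEmbedding]
    simp_rw [ft2_eq]
    rw [← integral_const_mul, ← integral_const_mul]
    congr 1
    ext q
    have : WithLp.toLp 2 (ξ, τ) - WithLp.toLp 2 q = WithLp.toLp 2 (ξ - q.1, τ - q.2) := rfl
    rw [this]
    have hpi : ((Real.pi : ℂ)) ≠ 0 := by simp [Real.pi_ne_zero]
    push_cast
    field_simp
  rw [h, enorm_mul]
  calc _ ≤ 1 * ‖∫ q : ℝ × ℝ, ft2 u q.1 q.2 * ft2 v (ξ - q.1) (τ - q.2)‖ₑ := by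
        gcongr
        rw [← ofReal_norm, ENNReal.ofReal_le_one, Complex.norm_real, Real.norm_eq_abs, abs_of_pos (by positivity)]
        apply inv_le_one_of_one_le₀
        nlinarith [Real.pi_gt_three]
    _ ≤ _ := by
        rw [one_mul]
        refine (enorm_integral_le_lintegral_enorm _).trans (le_of_eq ?_)
        simp_rw [enorm_mul]

theorem ft2_main (u v : SchwartzMap (ℝ × ℝ) ℂ) (ξ τ : ℝ) :
    ‖ft2 (fun p : ℝ × ℝ => deriv (fun x : ℝ => u (p.1, x) * v (p.1, x)) p.2) ξ τ‖ₑ ≤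
     ENNReal.ofReal |ξ| * ∫⁻ q : ℝ × ℝ, ‖ft2 u q.1 q.2‖ₑ * ‖ft2 v (ξ - q.1) (τ - q.2)‖ₑ := by
  have h := ft2_deriv (mulS u v) ξ τ
  have h' : (fun p : ℝ × ℝ => deriv (fun x : ℝ => (mulS u v) (p.1, x)) p.2) = (fun p : ℝ × ℝ => deriv (fun x : ℝ => u (p.1, x) * v (p.1, x)) p.2) := rfl
  rw [h'] at h
  rw [h, enorm_mul]
  refine mul_le_mul' (le_of_eq ?_) (ft2_conv u v ξ τ)
  rw [← ofReal_norm]; simp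

theorem jap_ge_one (x : ℝ) : 1 ≤ jap x := by
  unfold jap
  exact Real.one_le_rpow (by nlinarith [sq_nonneg x]) (by norm_num)

theorem jap_pos (x : ℝ) : 0 < jap x := lt_of_lt_of_le one_pos (jap_ge_one x)

theorem jap_eq_sqrt (x : ℝ) : jap x = Real.sqrt (1 + x ^ 2) := by
  rw [Real.sqrt_eq_rpow]; rfl

theorem jap_neg (x : ℝ) : jap (-x) = jap x := by unfold jap; simp

theorem jap_le_one_add (x : ℝ) : jap x ≤ 1 + |x| := by
  rw [jap_eq_sqrt, Real.sqrt_le_left (by positivity)]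
  nlinarith [abs_nonneg x, sq_abs x]

theorem abs_le_jap (x : ℝ) : |x| ≤ jap x := by
  rw [jap_eq_sqrt]
  apply Real.le_sqrt_of_sq_le
  rw [sq_abs]; linarith

theorem jap_mono {x y : ℝ} (h : |x| ≤ |y|) : jap x ≤ jap y := by
  rw [jap_eq_sqrt, jap_eq_sqrt]
  apply Real.sqrt_le_sqrt
  have := sq_le_sq.mpr h
  linarith

theorem jap_meas : Measurable jap := by unfold jap; fun_prop

/-- total mass of the bracket weight -/
noncomputable def JJ (p : ℝ) : ℝ≥0∞ := ∫⁻ x : ℝ, ENNReal.ofReal (jap x ^ (-p))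

theorem JJ_lt_top {p : ℝ} (hp : 1 < p) : JJ p < ⊤ := by
  have h := integrable_rpow_neg_one_add_norm_sq (E := ℝ) (μ := volume) (r := p) (by simpa using hp)
  have h2 : (fun x : ℝ => ((1 : ℝ) + ‖x‖ ^ 2) ^ (-p / 2)) = fun x => jap x ^ (-p) := by
    ext x
    unfold jap
    rw [← Real.rpow_mul (by positivity), Real.norm_eq_abs, sq_abs]
    congr 1; ring
  rw [h2] at h
  exact h.lintegral_lt_top

theorem jap_add_le (x y : ℝ) : jap (x + y) ≤ 2 * max (jap x) (jap y) := by
  rcases le_total |x| |y| with h | h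
  · rw [max_eq_right (jap_mono h)]
    rw [jap_eq_sqrt, jap_eq_sqrt, Real.sqrt_le_left (by positivity), mul_pow, Real.sq_sqrt (by positivity)]
    have := sq_le_sq.mpr h
    nlinarith [sq_nonneg (x - y)]
  · rw [max_eq_left (jap_mono h)]
    rw [jap_eq_sqrt, jap_eq_sqrt, Real.sqrt_le_left (by positivity), mul_pow, Real.sq_sqrt (by positivity)]
    have := sq_le_sq.mpr h
    nlinarith [sq_nonneg (x - y)]

theorem jap_prod_le {p : ℝ} (hp : 0 < p) (x y : ℝ) :
    jap x ^ (-p) * jap y ^ (-p) ≤ 2 ^ p * jap (x + y) ^ (-p) * (jap x ^ (-p) + jap y ^ (-p)) := by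
  have key : (max (jap x) (jap y)) ^ (-p) ≤ 2 ^ p * jap (x + y) ^ (-p) := by
    have h := Real.rpow_le_rpow_of_nonpos (jap_pos (x+y)) (jap_add_le x y) (z := -p) (by linarith)
    have hm : 0 < max (jap x) (jap y) := lt_max_of_lt_left (jap_pos x)
    rw [Real.mul_rpow (by norm_num) hm.le] at h
    have h2 : (2:ℝ) ^ p * 2 ^ (-p) = 1 := by rw [← Real.rpow_add (by norm_num)]; simp
    calc (max (jap x) (jap y)) ^ (-p) = 2 ^ p * (2 ^ (-p) * (max (jap x) (jap y)) ^ (-p)) := by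
          rw [← mul_assoc, h2, one_mul]
      _ ≤ _ := by gcongr
  have hx : 0 ≤ jap x ^ (-p) := Real.rpow_nonneg (jap_pos x).le _
  have hy : 0 ≤ jap y ^ (-p) := Real.rpow_nonneg (jap_pos y).le _
  rcases le_total (jap x) (jap y) with h | h
  · rw [max_eq_right h] at key
    calc jap x ^ (-p) * jap y ^ (-p) = jap y ^ (-p) * jap x ^ (-p) := by ring
      _ ≤ _ := mul_le_mul key (by linarith) hx (hy.trans key)
  · rw [max_eq_left h] at key
    exact mul_le_mul key (by linarith) hy (hx.trans key)

theorem conv_tau {p : ℝ} (hp : 0 < p) (A B : ℝ) :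
    ∫⁻ t : ℝ, ENNReal.ofReal (jap (t - A) ^ (-p)) * ENNReal.ofReal (jap (B - t) ^ (-p)) ≤
      ENNReal.ofReal (2 ^ p) * (2 * JJ p) * ENNReal.ofReal (jap (B - A) ^ (-p)) := by
  have hm : Measurable fun x : ℝ => ENNReal.ofReal (jap x ^ (-p)) :=
    (jap_meas.pow_const _).ennreal_ofReal
  calc _ ≤ ∫⁻ t : ℝ, ENNReal.ofReal (2 ^ p) * ENNReal.ofReal (jap (B - A) ^ (-p)) *
        (ENNReal.ofReal (jap (t - A) ^ (-p)) + ENNReal.ofReal (jap (B - t) ^ (-p))) := by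
        apply lintegral_mono
        intro t
        have h := jap_prod_le hp (t - A) (B - t)
        have e : t - A + (B - t) = B - A := by ring
        rw [e] at h
        have n1 : ∀ z, 0 ≤ jap z ^ (-p) := fun z => Real.rpow_nonneg (jap_pos z).le _
        have n2 : (0:ℝ) ≤ 2 ^ p := by positivity
        simp only
        rw [← ENNReal.ofReal_mul (n1 _), ← ENNReal.ofReal_mul n2, ← ENNReal.ofReal_add (n1 _) (n1 _),
          ← ENNReal.ofReal_mul (mul_nonneg n2 (n1 _))]
        exact ENNReal.ofReal_le_ofReal h
    _ = _ := by
        have m1 : Measurable fun t : ℝ => ENNReal.ofReal (jap (t - A) ^ (-p)) :=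
          hm.comp (measurable_id.sub_const A)
        have m2 : Measurable fun t : ℝ => ENNReal.ofReal (jap (B - t) ^ (-p)) :=
          hm.comp (measurable_id.const_sub B)
        rw [lintegral_const_mul _ (by fun_prop), lintegral_add_left m1]
        have e1 : ∫⁻ t : ℝ, ENNReal.ofReal (jap (t - A) ^ (-p)) = JJ p :=
          lintegral_sub_right_eq_self (fun x : ℝ => ENNReal.ofReal (jap x ^ (-p))) A
        have e2 : ∫⁻ t : ℝ, ENNReal.ofReal (jap (B - t) ^ (-p)) = JJ p :=
          lintegral_sub_left_eq_self (fun x : ℝ => ENNReal.ofReal (jap x ^ (-p))) B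
        rw [e1, e2]; ring

noncomputable def psi (α c x : ℝ) : ℝ := omegaBO α x + omegaBO α (c - x)

noncomputable def HH (α c x : ℝ) : ℝ :=
  |(|x| ^ (1 + α) - |c - x| ^ (1 + α))| +
    |c| ^ (α / 2) * (if |2 * x - c| ≤ |c| ^ (-(α / 2)) then 1 else 0) + (if |x| ≤ 4 then 1 else 0)

theorem omega_neg (α x : ℝ) : omegaBO α (-x) = - omegaBO α x := by
  unfold omegaBO; simp

theorem omega_hasDeriv {α : ℝ} (hα : 0 < α) (x : ℝ) :
    HasDerivAt (omegaBO α) (-(2 + α) * |x| ^ (1 + α)) x := by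
  rcases lt_trichotomy x 0 with h | h | h
  · have h1 : HasDerivAt (fun y : ℝ => (-y) ^ (2 + α)) ((2 + α) * |x| ^ (1 + α) * (-1)) x := by
      have h2 := (hasDerivAt_neg x).rpow_const (p := 2 + α) (Or.inl (by linarith))
      convert! h2 using 1
      rw [abs_of_neg h, show 2 + α - 1 = 1 + α by ring]; ring
    have h3 : omegaBO α =ᶠ[nhds x] (fun y : ℝ => (-y) ^ (2 + α)) := by
      filter_upwards [gt_mem_nhds h] with y hy
      unfold omegaBO
      have e : (-y) ^ (2 + α) = (-y) * (-y) ^ (1 + α) := by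
        rw [show 2 + α = 1 + (1 + α) by ring, Real.rpow_add (by linarith) 1 (1 + α), Real.rpow_one]
      simp only [abs_of_neg hy]
      rw [e]
    convert! h1.congr_of_eventuallyEq h3 using 1
    ring
  · subst h
    rw [abs_zero, Real.zero_rpow (by linarith), mul_zero]
    rw [hasDerivAt_iff_isLittleO_nhds_zero]
    simp only [zero_add, smul_eq_mul, mul_zero, sub_zero]
    have e : omegaBO α 0 = 0 := by unfold omegaBO; simp
    simp only [e, sub_zero]
    have ht : Filter.Tendsto (fun h : ℝ => |h| ^ (1 + α)) (nhds 0) (nhds 0) := by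
      have : Continuous (fun h : ℝ => |h| ^ (1 + α)) :=
        continuous_abs.rpow_const (fun _ => Or.inr (by linarith))
      have h := this.tendsto 0
      simpa [Real.zero_rpow (show 1 + α ≠ 0 by linarith)] using h
    have h2 : (fun h : ℝ => |h| ^ (1 + α)) =o[nhds 0] (fun _ => (1:ℝ)) :=
      (Asymptotics.isLittleO_one_iff ℝ).mpr ht
    have h3 := (Asymptotics.isBigO_refl (fun h : ℝ => -h) (nhds 0)).mul_isLittleO h2
    simp only [mul_one] at h3
    exact h3.neg_right.congr_right (fun x => by simp) 
  · have h1 : HasDerivAt (fun y : ℝ => -(y ^ (2 + α))) (-((2 + α) * |x| ^ (1 + α))) x := by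
      have h2 := ((hasDerivAt_id x).rpow_const (p := 2 + α) (Or.inl (ne_of_gt h))).neg
      convert! h2 using 1
      simp only [id]
      rw [abs_of_pos h, show 2 + α - 1 = 1 + α by ring]; ring
    have h3 : omegaBO α =ᶠ[nhds x] (fun y : ℝ => -(y ^ (2 + α))) := by
      filter_upwards [lt_mem_nhds h] with y hy
      unfold omegaBO
      have e : y ^ (2 + α) = y * y ^ (1 + α) := by
        rw [show 2 + α = 1 + (1 + α) by ring, Real.rpow_add hy 1 (1 + α), Real.rpow_one]
      simp only [abs_of_pos hy]
      rw [e]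
      ring
    convert! h1.congr_of_eventuallyEq h3 using 1
    ring

theorem psi_hasDeriv {α : ℝ} (hα : 0 < α) (c x : ℝ) :
    HasDerivAt (psi α c) (-(2 + α) * (|x| ^ (1 + α) - |c - x| ^ (1 + α))) x := by
  have h1 := omega_hasDeriv hα x
  have h2 := (omega_hasDeriv hα (c - x)).comp x ((hasDerivAt_id x).const_sub c)
  convert! h1.add h2 using 1
  ring

theorem omega_meas (α : ℝ) : Measurable (omegaBO α) := by
  unfold omegaBO; fun_prop

theorem psi_inj {α : ℝ} (hα : 0 < α) {c : ℝ} (s : Set ℝ) (hs : Convex ℝ s)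
    (h : (∀ x ∈ s, |x| < |c - x|) ∨ (∀ x ∈ s, |c - x| < |x|)) : Set.InjOn (psi α c) s := by
  have hc : ContinuousOn (psi α c) s := fun x _ => (psi_hasDeriv hα c x).continuousAt.continuousWithinAt
  rcases h with h | h
  · apply StrictMonoOn.injOn
    apply strictMonoOn_of_deriv_pos hs hc
    intro x hx
    rw [(psi_hasDeriv hα c x).deriv]
    have := Real.rpow_lt_rpow (abs_nonneg _) (h x (interior_subset hx)) (show 0 < 1 + α by linarith)
    nlinarith
  · apply StrictAntiOn.injOn
    apply strictAntiOn_of_deriv_neg hs hc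
    intro x hx
    rw [(psi_hasDeriv hα c x).deriv]
    have := Real.rpow_lt_rpow (abs_nonneg _) (h x (interior_subset hx)) (show 0 < 1 + α by linarith)
    nlinarith

theorem psi_piece {α : ℝ} (hα : 0 < α) {c : ℝ} (a p : ℝ) (s : Set ℝ) (hm : MeasurableSet s) (hs : Convex ℝ s)
    (h : (∀ x ∈ s, |x| < |c - x|) ∨ (∀ x ∈ s, |c - x| < |x|)) :
    ∫⁻ x in s, ENNReal.ofReal |(|x| ^ (1 + α) - |c - x| ^ (1 + α))| *
      ENNReal.ofReal (jap (a - psi α c x) ^ (-p)) ≤ JJ p := by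
  have h1 := lintegral_image_eq_lintegral_abs_deriv_mul hm
    (fun x _ => (psi_hasDeriv hα c x).hasDerivWithinAt) (psi_inj hα s hs h)
    (fun y => ENNReal.ofReal (jap (a - y) ^ (-p)))
  calc _ ≤ ∫⁻ x in s, ENNReal.ofReal |(-(2 + α) * (|x| ^ (1 + α) - |c - x| ^ (1 + α)))| *
      ENNReal.ofReal (jap (a - psi α c x) ^ (-p)) := by
        apply lintegral_mono
        intro x
        simp only
        refine mul_le_mul' (ENNReal.ofReal_le_ofReal ?_) le_rfl
        rw [abs_mul]
        have : 1 ≤ |(-(2 + α))| := by rw [abs_neg, abs_of_pos (by linarith)]; linarith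
        nlinarith [abs_nonneg (|x| ^ (1 + α) - |c - x| ^ (1 + α))]
    _ = _ := h1.symm
    _ ≤ ∫⁻ y, ENNReal.ofReal (jap (a - y) ^ (-p)) := setLIntegral_le_lintegral _ _
    _ = JJ p := lintegral_sub_left_eq_self (fun x : ℝ => ENNReal.ofReal (jap x ^ (-p))) a

theorem psi_whole {α : ℝ} (hα : 0 < α) (c a p : ℝ) :
    ∫⁻ x, ENNReal.ofReal |(|x| ^ (1 + α) - |c - x| ^ (1 + α))| *
      ENNReal.ofReal (jap (a - psi α c x) ^ (-p)) ≤ 2 * JJ p := by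
  by_cases hc : c = 0
  · subst hc; simp
  have hu : (Set.univ : Set ℝ) = Set.Iic (c / 2) ∪ Set.Ioi (c / 2) := by simp
  rw [← setLIntegral_univ, hu]
  refine (lintegral_union_le _ _ _).trans ?_
  rw [two_mul, setLIntegral_congr Iio_ae_eq_Iic.symm]
  rcases lt_or_gt_of_ne hc with h | h
  · apply add_le_add
    · apply psi_piece hα a p _ measurableSet_Iio (convex_Iio _)
      right; intro x hx
      rw [← sq_lt_sq]; simp only [Set.mem_Iio] at hx; nlinarith
    · apply psi_piece hα a p _ measurableSet_Ioi (convex_Ioi _)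
      left; intro x hx
      rw [← sq_lt_sq]; simp only [Set.mem_Ioi] at hx; nlinarith
  · apply add_le_add
    · apply psi_piece hα a p _ measurableSet_Iio (convex_Iio _)
      left; intro x hx
      rw [← sq_lt_sq]; simp only [Set.mem_Iio] at hx; nlinarith
    · apply psi_piece hα a p _ measurableSet_Ioi (convex_Ioi _)
      right; intro x hx
      rw [← sq_lt_sq]; simp only [Set.mem_Ioi] at hx; nlinarith

theorem HH_meas (α : ℝ) : Measurable (fun z : ℝ × ℝ => HH α z.1 z.2) := by
  unfold HH
  apply Measurable.add
  · apply Measurable.add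
    · fun_prop
    · apply Measurable.mul (by fun_prop)
      apply Measurable.ite _ measurable_const measurable_const
      apply measurableSet_le <;> fun_prop
  · apply Measurable.ite _ measurable_const measurable_const
    apply measurableSet_le <;> fun_prop

theorem phi_bound {α : ℝ} (hα : 0 < α) {p : ℝ} (hp : 0 < p) (c a : ℝ) :
    ∫⁻ x, ENNReal.ofReal (HH α c x) * ENNReal.ofReal (jap (a - psi α c x) ^ (-p)) ≤ 2 * JJ p + 9 := by
  have hw : ∀ z, ENNReal.ofReal (jap z ^ (-p)) ≤ 1 := fun z => by
    rw [ENNReal.ofReal_le_one]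
    exact Real.rpow_le_one_of_one_le_of_nonpos (jap_ge_one z) (by linarith)
  have hpm : Measurable (psi α c) := by
    unfold psi; exact (omega_meas α).add ((omega_meas α).comp (by fun_prop))
  have hjm : Measurable fun x => ENNReal.ofReal (jap (a - psi α c x) ^ (-p)) :=
    ((jap_meas.comp (hpm.const_sub a)).pow_const _).ennreal_ofReal
  calc _ ≤ ∫⁻ x, (ENNReal.ofReal |(|x| ^ (1 + α) - |c - x| ^ (1 + α))| *
      ENNReal.ofReal (jap (a - psi α c x) ^ (-p)) +
        ((Metric.closedBall (c / 2) (|c| ^ (-(α / 2)) / 2)).indicator (fun _ => ENNReal.ofReal (|c| ^ (α / 2))) x +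
         (Metric.closedBall (0:ℝ) 4).indicator (fun _ => 1) x)) := by
        apply lintegral_mono
        intro x
        simp only
        unfold HH
        have h1 : 0 ≤ |c| ^ (α / 2) * (if |2 * x - c| ≤ |c| ^ (-(α / 2)) then (1:ℝ) else 0) := by positivity
        rw [ENNReal.ofReal_add (by positivity) (by positivity), ENNReal.ofReal_add (by positivity) (by positivity),
          add_assoc, add_mul]
        gcongr
        refine (mul_le_of_le_one_right' (hw _)).trans ?_
        gcongr
        · by_cases h : |2 * x - c| ≤ |c| ^ (-(α / 2))
          · have : x ∈ Metric.closedBall (c / 2) (|c| ^ (-(α / 2)) / 2) := by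
              rw [Metric.mem_closedBall, Real.dist_eq]
              have e : 2 * x - c = 2 * (x - c / 2) := by ring
              rw [e, abs_mul, abs_two] at h
              linarith
            rw [Set.indicator_of_mem this]; simp [h]
          · simp [h]
        · by_cases h : |x| ≤ 4
          · have : x ∈ Metric.closedBall (0:ℝ) 4 := by simpa using h
            rw [Set.indicator_of_mem this]; simp [h]
          · simp [h]
    _ ≤ 2 * JJ p + 9 := by
        rw [lintegral_add_right _ (by
          apply Measurable.add
          · exact measurable_const.indicator Metric.isClosed_closedBall.measurableSet
          · exact measurable_const.indicator Metric.isClosed_closedBall.measurableSet)]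
        gcongr
        · exact psi_whole hα c a p
        rw [lintegral_add_left (measurable_const.indicator Metric.isClosed_closedBall.measurableSet),
          lintegral_indicator Metric.isClosed_closedBall.measurableSet,
          lintegral_indicator Metric.isClosed_closedBall.measurableSet, setLIntegral_const, setLIntegral_const,
          Real.volume_closedBall, Real.volume_closedBall]
        have : (9:ℝ≥0∞) = 1 + 8 := by norm_num
        rw [this]
        gcongr
        · rw [← ENNReal.ofReal_mul (by positivity), ENNReal.ofReal_le_one]
          by_cases hc : c = 0
          · subst hc; simp [Real.zero_rpow (show α / 2 ≠ 0 by linarith)]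
          · have : |c| ^ (α/2) * |c| ^ (-(α/2)) = 1 := by
              rw [← Real.rpow_add (abs_pos.mpr hc)]; simp
            linarith
        · norm_num

theorem log_le_pow {u v : ℝ} (k : ℕ) (hu : 0 < u) (h : u ≤ 2 ^ k * v) :
    Real.log u ≤ Real.log v + k := by
  have hv : 0 < v := by
    have := hu.trans_le h
    exact (pos_iff_pos_of_mul_pos this).mp (by positivity)
  have h1 := Real.log_le_log hu h
  rw [Real.log_mul (by positivity) hv.ne', Real.log_pow] at h1
  have h2 : Real.log 2 ≤ 1 := by linarith [Real.log_two_lt_d9]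
  have : (k:ℝ) * Real.log 2 ≤ k := mul_le_of_le_one_right (by positivity) h2
  linarith

theorem log_jap (x : ℝ) : |Real.log (jap x) - max (Real.log |x|) 0| ≤ 1 := by
  have h2 : Real.log 2 ≤ 1 := by linarith [Real.log_two_lt_d9]
  rcases le_total 1 |x| with h | h
  · rw [max_eq_left (Real.log_nonneg h)]
    have h1 := Real.log_le_log (by linarith) (abs_le_jap x)
    have h3 := log_le_pow (u := jap x) (v := |x|) 1 (jap_pos x) (by linarith [jap_le_one_add x])
    rw [abs_le]; constructor <;> push_cast at h3 <;> linarith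
  · rw [max_eq_right (Real.log_nonpos (abs_nonneg x) h)]
    have h1 := Real.log_nonneg (jap_ge_one x)
    have h3 := log_le_pow (u := jap x) (v := 1) 1 (jap_pos x) (by linarith [jap_le_one_add x])
    rw [abs_le]; constructor <;> push_cast at h3 <;> simp at h3 ⊢ <;> linarith

noncomputable def RR (x y : ℝ) : ℝ := jap x * jap y / jap (x + y)

theorem RR_pos (x y : ℝ) : 0 < RR x y := div_pos (mul_pos (jap_pos x) (jap_pos y)) (jap_pos _)

theorem log_RR (x y : ℝ) : |Real.log (RR x y) -
    (max (Real.log |x|) 0 + max (Real.log |y|) 0 - max (Real.log |x + y|) 0)| ≤ 3 := by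
  unfold RR
  rw [Real.log_div (mul_pos (jap_pos x) (jap_pos y)).ne' (jap_pos _).ne',
    Real.log_mul (jap_pos x).ne' (jap_pos y).ne']
  have h1 := abs_le.mp (log_jap x)
  have h2 := abs_le.mp (log_jap y)
  have h3 := abs_le.mp (log_jap (x + y))
  rw [abs_le]; constructor <;> linarith

theorem pow_diff {a b α : ℝ} (ha : 0 ≤ a) (hab : a ≤ b) (hα : 0 < α) :
    (b - a) * b ^ α ≤ b ^ (1 + α) - a ^ (1 + α) := by
  have e : ∀ c : ℝ, 0 ≤ c → c ^ (1 + α) = c * c ^ α := fun c hc => by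
    rw [Real.rpow_add_of_nonneg hc zero_le_one hα.le, Real.rpow_one]
  rw [e a ha, e b (ha.trans hab)]
  have := Real.rpow_le_rpow ha hab hα.le
  nlinarith

theorem abs_sub_abs' (x c l : ℝ) (h1 : l ≤ |c|) (h2 : l ≤ |2 * x - c|) :
    l ≤ |(|x| - |c - x|)| := by
  rcases le_total 0 x with a | a <;> rcases le_total 0 (c - x) with b | b
  · rw [abs_of_nonneg a, abs_of_nonneg b]; convert h2 using 2; ring
  · rw [abs_of_nonneg a, abs_of_nonpos b]; convert h1 using 2; ring
  · rw [abs_of_nonpos a, abs_of_nonneg b]; rw [← abs_neg] at h1; convert h1 using 2; ring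
  · rw [abs_of_nonpos a, abs_of_nonpos b]; rw [← abs_neg] at h2; convert h2 using 2; ring

theorem HH_first {α : ℝ} (_hα : 0 < α) (c x : ℝ) :
    |(|x| ^ (1 + α) - |c - x| ^ (1 + α))| ≤ HH α c x := by
  unfold HH
  have h1 : 0 ≤ |c| ^ (α / 2) * (if |2 * x - c| ≤ |c| ^ (-(α / 2)) then (1:ℝ) else 0) := by positivity
  have h2 : 0 ≤ (if |x| ≤ 4 then (1:ℝ) else 0) := by positivity
  linarith

theorem HH_nonneg {α : ℝ} (hα : 0 < α) (c x : ℝ) : 0 ≤ HH α c x :=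
  (abs_nonneg _).trans (HH_first hα c x)

theorem HH_one {α : ℝ} (hα : 0 < α) (c x n l : ℝ) (hn : 0 ≤ n) (hl : 0 ≤ l)
    (h1 : l ≤ |c|) (h2 : l ≤ |2 * x - c|) (h3 : n ≤ |x| ∨ n ≤ |c - x|) :
    n ^ α * l ≤ HH α c x := by
  refine le_trans ?_ (HH_first hα c x)
  have h4 := abs_sub_abs' x c l h1 h2
  rcases le_total |x| |c - x| with h | h
  · have h5 := pow_diff (abs_nonneg x) h hα
    rw [abs_of_nonpos (by linarith)] at h4
    have h6 : n ^ α ≤ |c - x| ^ α := Real.rpow_le_rpow hn (by rcases h3 with h3 | h3 <;> linarith) hα.le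
    rw [abs_sub_comm]
    refine le_trans ?_ (h5.trans (le_abs_self _))
    rw [mul_comm]
    exact mul_le_mul (by linarith) h6 (by positivity) (by linarith)
  · have h5 := pow_diff (abs_nonneg (c - x)) h hα
    rw [abs_of_nonneg (by linarith)] at h4
    have h6 : n ^ α ≤ |x| ^ α := Real.rpow_le_rpow hn (by rcases h3 with h3 | h3 <;> linarith) hα.le
    refine le_trans ?_ (h5.trans (le_abs_self _))
    rw [mul_comm]
    exact mul_le_mul (by linarith) h6 (by positivity) (by linarith)

theorem HH_one_log {α : ℝ} (hα : 0 < α) (c x n l : ℝ) (hn : 0 < n) (hl : 0 < l)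
    (h1 : l ≤ |c|) (h2 : l ≤ |2 * x - c|) (h3 : n ≤ |x| ∨ n ≤ |c - x|) :
    0 < HH α c x ∧ α * Real.log n + Real.log l ≤ Real.log (HH α c x) := by
  have h := HH_one hα c x n l hn.le hl.le h1 h2 h3
  have hp : 0 < n ^ α * l := by positivity
  refine ⟨hp.trans_le h, ?_⟩
  have := Real.log_le_log hp h
  rwa [Real.log_mul (by positivity) hl.ne', Real.log_rpow hn] at this

theorem HH_two_log {α : ℝ} (hα : 0 < α) (hα1 : α ≤ 1) (c x : ℝ) (hc : 1 / 2 ≤ |c|) :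
    0 < HH α c x ∧ α / 2 * Real.log |c| ≤ Real.log (HH α c x) + 3 := by
  have hc0 : 0 < |c| := by linarith
  by_cases h : |2 * x - c| ≤ |c| ^ (-(α / 2))
  · have h1 : |c| ^ (α / 2) ≤ HH α c x := by
      unfold HH
      rw [if_pos h]
      have h2 : 0 ≤ (if |x| ≤ 4 then (1:ℝ) else 0) := by positivity
      linarith [abs_nonneg (|x| ^ (1 + α) - |c - x| ^ (1 + α))]
    have h0 : 0 < |c| ^ (α / 2) := by positivity
    refine ⟨h0.trans_le h1, ?_⟩
    have := Real.log_le_log h0 h1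
    rw [Real.log_rpow hc0] at this
    linarith
  · push Not at h
    have hd : 0 < |c| ^ (-(α / 2)) := by positivity
    have hm : |c| / 2 ≤ |x| ∨ |c| / 2 ≤ |c - x| := by
      by_contra hcon
      push Not at hcon
      have := abs_add_le x (c - x)
      rw [show x + (c - x) = c by ring] at this
      linarith
    have hlc : -1 ≤ Real.log |c| := by
      have := log_le_pow (u := 1/2) (v := |c|) 0 (by norm_num) (by simpa using hc)
      rw [one_div, Real.log_inv] at this
      have h2 : Real.log 2 ≤ 1 := by linarith [Real.log_two_lt_d9]
      push_cast at this; linarith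
    have hl2 : Real.log |c| ≤ Real.log (|c| / 2) + 1 := by
      have := log_le_pow (u := |c|) (v := |c| / 2) 1 hc0 (by linarith)
      simpa using this
    rcases le_total (|c| ^ (-(α / 2))) |c| with h5 | h5
    · obtain ⟨ha, hb⟩ := HH_one_log hα c x (|c| / 2) (|c| ^ (-(α / 2))) (by positivity) hd h5 h.le hm
      refine ⟨ha, ?_⟩
      rw [Real.log_rpow hc0] at hb
      nlinarith
    · obtain ⟨ha, hb⟩ := HH_one_log hα c x (|c| / 2) |c| (by positivity) hc0 le_rfl (h5.trans h.le) hm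
      refine ⟨ha, ?_⟩
      nlinarith

theorem HH_three {α : ℝ} (_hα : 0 < α) (c x : ℝ) (hx : |x| ≤ 4) : 1 ≤ HH α c x := by
  unfold HH
  rw [if_pos hx]
  have h1 : 0 ≤ |c| ^ (α / 2) * (if |2 * x - c| ≤ |c| ^ (-(α / 2)) then (1:ℝ) else 0) := by positivity
  linarith [abs_nonneg (|x| ^ (1 + α) - |c - x| ^ (1 + α))]

theorem omega_sum {α : ℝ} (hα : 0 < α) (hα1 : α ≤ 1) {B C l n : ℝ} (hB : 0 ≤ B) (hC : 0 ≤ C)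
    (hl : 0 ≤ l) (hn : 0 ≤ n) (h1 : l ≤ B) (h2 : l ≤ C) (h3 : n ≤ B + C) :
    l * n ^ (1 + α) ≤ 4 * (omegaBO α B + omegaBO α C - omegaBO α (B + C)) := by
  unfold omegaBO
  rw [abs_of_nonneg hB, abs_of_nonneg hC, abs_of_nonneg (add_nonneg hB hC)]
  have hs : B ^ (1 + α) + C ^ (1 + α) ≤ (B + C) ^ (1 + α) :=
    Real.add_rpow_le_rpow_add hB hC (by linarith)
  have hb : 0 ≤ B ^ (1 + α) := by positivity
  have hc : 0 ≤ C ^ (1 + α) := by positivity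
  have h4 : n ^ (1 + α) ≤ 4 * (n / 2) ^ (1 + α) := by
    rw [Real.div_rpow hn (by norm_num)]
    have h2 : (2:ℝ) ^ (1 + α) ≤ 4 := by
      calc (2:ℝ) ^ (1 + α) ≤ 2 ^ (2:ℝ) := Real.rpow_le_rpow_of_exponent_le (by norm_num) (by linarith)
        _ = 4 := by norm_num
    have h5 : (0:ℝ) < 2 ^ (1 + α) := by positivity
    rw [← mul_div_assoc, le_div_iff₀ h5]
    have : 0 ≤ n ^ (1 + α) := by positivity
    nlinarith
  have key : l * (n / 2) ^ (1 + α) ≤ B * C ^ (1 + α) + C * B ^ (1 + α) := by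
    rcases le_total B C with h | h
    · have : (n / 2) ^ (1 + α) ≤ C ^ (1 + α) := Real.rpow_le_rpow (by linarith) (by linarith) (by linarith)
      have h6 : l * (n / 2) ^ (1 + α) ≤ B * C ^ (1 + α) := mul_le_mul h1 this (by positivity) hB
      nlinarith
    · have : (n / 2) ^ (1 + α) ≤ B ^ (1 + α) := Real.rpow_le_rpow (by linarith) (by linarith) (by linarith)
      have h6 : l * (n / 2) ^ (1 + α) ≤ C * B ^ (1 + α) := mul_le_mul h2 this (by positivity) hC
      nlinarith
  have h7 : l * n ^ (1 + α) ≤ 4 * (l * (n / 2) ^ (1 + α)) := by nlinarith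
  nlinarith

theorem omega_lower {α : ℝ} (hα : 0 < α) (hα1 : α ≤ 1) {x y l n : ℝ} 
    (hl : 0 ≤ l) (hn : 0 ≤ n) (h1 : l ≤ |x|) (h2 : l ≤ |y|) (h3 : l ≤ |x + y|) (h4 : n ≤ |x| ∨ n ≤ |y|) :
    l * n ^ (1 + α) ≤ 4 * |omegaBO α (x + y) - omegaBO α x - omegaBO α y| := by
  have key : ∀ B C : ℝ, 0 ≤ B → 0 ≤ C → l ≤ B → l ≤ C → n ≤ B + C →
      (omegaBO α B + omegaBO α C - omegaBO α (B + C) = omegaBO α (x + y) - omegaBO α x - omegaBO α y ∨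
       omegaBO α B + omegaBO α C - omegaBO α (B + C) = -(omegaBO α (x + y) - omegaBO α x - omegaBO α y)) →
      l * n ^ (1 + α) ≤ 4 * |omegaBO α (x + y) - omegaBO α x - omegaBO α y| := by
    intro B C hB hC hlB hlC hnB he
    have h := omega_sum hα hα1 hB hC hl hn hlB hlC hnB
    rcases he with he | he
    · rw [he] at h; linarith [le_abs_self (omegaBO α (x + y) - omegaBO α x - omegaBO α y)]
    · rw [he] at h; linarith [neg_abs_le (omegaBO α (x + y) - omegaBO α x - omegaBO α y)]
  rcases le_total 0 x with hx | hx <;> rcases le_total 0 y with hy | hy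
  · rw [abs_of_nonneg hx] at *; rw [abs_of_nonneg hy] at *
    exact key x y hx hy h1 h2 (by rcases h4 with h | h <;> linarith) (Or.inr (by ring))
  · rcases le_total 0 (x + y) with hz | hz <;> rw [abs_of_nonneg hx, abs_of_nonpos hy] at h4 <;>
      rw [abs_of_nonneg hx] at h1 <;> rw [abs_of_nonpos hy] at h2
    · rw [abs_of_nonneg hz] at h3
      refine key (x + y) (-y) hz (by linarith) h3 h2 (by rcases h4 with h | h <;> linarith) (Or.inl ?_)
      rw [omega_neg, show x + y + -y = x by ring]; ring
    · rw [abs_of_nonpos hz] at h3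
      refine key x (-(x + y)) hx (by linarith) h1 h3 (by rcases h4 with h | h <;> linarith) (Or.inr ?_)
      rw [omega_neg, show x + -(x + y) = -y by ring, omega_neg]; ring
  · rcases le_total 0 (x + y) with hz | hz <;> rw [abs_of_nonpos hx, abs_of_nonneg hy] at h4 <;>
      rw [abs_of_nonpos hx] at h1 <;> rw [abs_of_nonneg hy] at h2
    · rw [abs_of_nonneg hz] at h3
      refine key (x + y) (-x) hz (by linarith) h3 h1 (by rcases h4 with h | h <;> linarith) (Or.inl ?_)
      rw [omega_neg, show x + y + -x = y by ring]; ring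
    · rw [abs_of_nonpos hz] at h3
      refine key y (-(x + y)) hy (by linarith) h2 h3 (by rcases h4 with h | h <;> linarith) (Or.inr ?_)
      rw [omega_neg, show y + -(x + y) = -x by ring, omega_neg]; ring
  · rw [abs_of_nonpos hx, abs_of_nonpos hy] at h4
    rw [abs_of_nonpos hx] at h1; rw [abs_of_nonpos hy] at h2
    refine key (-x) (-y) (by linarith) (by linarith) h1 h2 (by rcases h4 with h | h <;> linarith) (Or.inl ?_)
    rw [show -x + -y = -(x + y) by ring, omega_neg, omega_neg, omega_neg]; ring

theorem omega_log {α : ℝ} (hα : 0 < α) (hα1 : α ≤ 1) {x y l n T : ℝ}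
    (hl : 0 < l) (hn : 0 < n) (h1 : l ≤ |x|) (h2 : l ≤ |y|) (h3 : l ≤ |x + y|) (h4 : n ≤ |x| ∨ n ≤ |y|)
    (hT : |omegaBO α (x + y) - omegaBO α x - omegaBO α y| ≤ 3 * T) :
    Real.log l + (1 + α) * Real.log n ≤ Real.log T + 4 := by
  have h := omega_lower hα hα1 hl.le hn.le h1 h2 h3 h4
  have hp : 0 < l * n ^ (1 + α) := by positivity
  have := log_le_pow (u := l * n ^ (1 + α)) (v := T) 4 hp (by
    have : 0 < T := by nlinarith
    norm_num; linarith)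
  rwa [Real.log_mul hl.ne' (by positivity), Real.log_rpow hn] at this

theorem exp_form {Z R T H σ β a K : ℝ} (hZ : 0 < Z) (hR : 0 < R) (hT : 0 < T) (hH : 0 < H)
    (h : Real.log Z + σ * Real.log R - β * Real.log T ≤ K + a * Real.log H) :
    Z * R ^ σ * T ^ (-β) ≤ Real.exp K * H ^ a := by
  rw [Real.rpow_def_of_pos hR, Real.rpow_def_of_pos hT, Real.rpow_def_of_pos hH]
  nth_rewrite 1 [← Real.exp_log hZ]
  rw [← Real.exp_add, ← Real.exp_add, ← Real.exp_add]
  apply Real.exp_le_exp.mpr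
  linarith

structure Cond (α a σ ε : ℝ) : Prop where
  a0 : 0 < α
  a1 : α ≤ 1
  ha : 1 / 2 < a
  ha1 : a < 1
  hal : 1 < a * (1 + α)
  e0 : 0 < ε
  b0 : 0 ≤ 1 - a - 2 * ε
  q1 : -α + 2 * ε * (1 + α) ≤ 0
  q2 : σ - (1 - a) + 2 * ε - α + 2 * ε * (1 + α) ≤ 0
  q3 : 2 * σ - (1 + α) * (1 - a - 2 * ε) - a * α ≤ 0
  q4 : 2 * σ - (1 + α) * (1 - a - 2 * ε) - a * α + 2 * ε - σ ≤ 0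
  q5 : 1 + σ - (2 + α) * (1 - a - 2 * ε) - a * α / 2 ≤ 0
  p1 : σ - a + 2 * ε + (1 + ε) * (2 * a - 1) - α + 2 * ε * (1 + α) ≤ 0
  p2 : 1 - (a - 2 * ε) * (1 + α) - (1 - a) * α ≤ 0
  p3 : 1 - (a - 2 * ε) * (1 + α) - (1 - a) * α + (σ - (a - 2 * ε) - (1 - a) + (1 + ε) * (2 * a - 1)) ≤ 0
  p4 : 2 * σ - (1 + α) * (a - 2 * ε) - (1 - a) * (1 + α) + (1 + ε) * (2 * a - 1) ≤ 0
  p5 : 2 * σ - (1 + α) * (a - 2 * ε) - (1 - a) * (1 + α) + (1 + ε) * (2 * a - 1) + (1 - a) + 2 * ε - σ ≤ 0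
  p6 : 1 + σ - (2 + α) * (a - 2 * ε) + (1 + ε) * (2 * a - 1) - α / 2 * (1 - a) ≤ 0

theorem lin_eps {A B : ℝ} (hA : A < 0) : ∀ᶠ ε in nhdsWithin (0:ℝ) (Set.Ioi 0), A + B * ε ≤ 0 := by
  have : Filter.Tendsto (fun ε : ℝ => A + B * ε) (nhdsWithin (0:ℝ) (Set.Ioi 0)) (nhds (A + B * 0)) :=
    (Continuous.tendsto (by fun_prop) 0).mono_left nhdsWithin_le_nhds
  rw [mul_zero, add_zero] at this
  filter_upwards [this.eventually (gt_mem_nhds hA)] with ε h using h.le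

theorem exists_cond {α a σ : ℝ} (a0 : 0 < α) (a1 : α ≤ 1) (ha1 : a < 1) (hal : 1 < a * (1 + α))
    (hσ : σ < 1 + α - (2 + α / 2) * a) : ∃ ε, Cond α a σ ε := by
  have ha : 1 / 2 < a := by nlinarith
  have w := mul_pos a0 (show 0 < a by linarith)
  have t3 : 2 * σ - (1 + α) * (1 - a) - a * α < 0 := by nlinarith
  have t4 : 2 * σ - (1 + α) * (1 - a) - a * α - σ < 0 := by nlinarith
  have h := ((((((((((((lin_eps (A := -(1 - a)) (B := 2) (by linarith)).and
    (lin_eps (A := -α) (B := 2 * (1 + α)) (by linarith))).and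
    (lin_eps (A := σ - (1 - a) - α) (B := 2 + 2 * (1 + α)) (by nlinarith))).and
    (lin_eps (B := (1 + α) * 2) t3)).and
    (lin_eps (B := (1 + α) * 2 + 2) t4)).and
    (lin_eps (A := 1 + σ - (2 + α) * (1 - a) - a * α / 2) (B := (2 + α) * 2) (by nlinarith))).and
    (lin_eps (A := σ - a + (2 * a - 1) - α) (B := 2 + (2 * a - 1) + 2 * (1 + α)) (by nlinarith))).and
    (lin_eps (A := 1 - a * (1 + α) - (1 - a) * α) (B := 2 * (1 + α)) (by nlinarith))).and
    (lin_eps (A := 1 - a * (1 + α) - (1 - a) * α + (σ - a - (1 - a) + (2 * a - 1)))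
      (B := 2 * (1 + α) + 2 + (2 * a - 1)) (by nlinarith))).and
    (lin_eps (A := 2 * σ - (1 + α) * a - (1 - a) * (1 + α) + (2 * a - 1))
      (B := 2 * (1 + α) + (2 * a - 1)) (by nlinarith))).and
    (lin_eps (A := 2 * σ - (1 + α) * a - (1 - a) * (1 + α) + (2 * a - 1) + (1 - a) - σ)
      (B := 2 * (1 + α) + (2 * a - 1) + 2) (by nlinarith))).and
    (lin_eps (A := 1 + σ - (2 + α) * a + (2 * a - 1) - α / 2 * (1 - a))
      (B := 2 * (2 + α) + (2 * a - 1)) (by nlinarith))).and self_mem_nhdsWithin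
  obtain ⟨ε, ⟨⟨⟨⟨⟨⟨⟨⟨⟨⟨⟨⟨c0, c1⟩, c2⟩, c3⟩, c4⟩, c5⟩, d1⟩, d2⟩, d3⟩, d4⟩, d5⟩, d6⟩, he⟩⟩ := h.exists
  have he : 0 < ε := he
  exact ⟨ε, a0, a1, ha, ha1, hal, he, by linarith, by linarith, by linarith, by linarith, by linarith,
    by linarith, by linarith, by linarith, by linarith, by linarith, by linarith, by linarith⟩

theorem sig_le {σ u v k : ℝ} (h : |u - v| ≤ k) : σ * u ≤ σ * v + |σ| * k := by
  have : σ * (u - v) ≤ |σ| * k := by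
    calc σ * (u - v) ≤ |σ * (u - v)| := le_abs_self _
      _ = |σ| * |u - v| := abs_mul _ _
      _ ≤ _ := by gcongr
  linarith

theorem PA_core {α a σ ε : ℝ} (C : Cond α a σ ε) {x y T H : ℝ} (hxy : |y| ≤ |x|) (hy : 1 ≤ |y|)
    (hT1 : 1 ≤ T) (hT : |omegaBO α (x + y) - omegaBO α x - omegaBO α y| ≤ 3 * T) (hH0 : 0 ≤ H)
    (hH1 : ∀ n l, 0 < n → 0 < l → l ≤ |x + y| → l ≤ |x - y| → n ≤ |x| →
      0 < H ∧ α * Real.log n + Real.log l ≤ Real.log H)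
    (hH2 : 1 / 2 ≤ |x + y| → 0 < H ∧ α / 2 * Real.log |x + y| ≤ Real.log H + 3) :
    |x + y| * RR x y ^ σ * T ^ (-(1 - a - 2 * ε)) ≤ Real.exp (50 + 50 * |σ|) * H ^ a := by
  obtain ⟨a0, a1, ha, ha1, hal, e0, b0, q1, q2, q3, q4, q5, -, -, -, -, -, -⟩ := C
  rcases (abs_nonneg (x + y)).eq_or_lt with hz | hz
  · rw [← hz]; simp; positivity
  have hx : 1 ≤ |x| := hy.trans hxy
  have hX : 0 < |x| := by linarith
  have hY : 0 < |y| := by linarith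
  have lx0 := Real.log_nonneg hx
  have ly0 := Real.log_nonneg hy
  have lyx := Real.log_le_log hY hxy
  have t1 : |x + y| ≤ |x| + |y| := abs_add_le x y
  have t2 : |x| - |y| ≤ |x + y| := by
    have := abs_sub_abs_le_abs_sub x (-y)
    rwa [abs_neg, sub_neg_eq_add] at this
  have t3 : |x| - |y| ≤ |x - y| := abs_sub_abs_le_abs_sub x y
  have t4 : 2 * |x| - |x + y| ≤ |x - y| := by
    have := abs_add_le (x + y) (x - y)
    rw [show x + y + (x - y) = 2 * x by ring, abs_mul, abs_two] at this
    linarith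
  have hR := log_RR x y
  rw [max_eq_left lx0, max_eq_left ly0] at hR
  have hσ := abs_nonneg σ
  have zx : Real.log |x + y| ≤ Real.log |x| + 1 := by
    simpa using log_le_pow (u := |x + y|) (v := |x|) 1 hz (by linarith)
  rcases le_total (2 * |y|) |x| with h1 | h1
  · -- separated frequencies
    have xz : Real.log |x| ≤ Real.log |x + y| + 1 := by
      simpa using log_le_pow (u := |x|) (v := |x + y|) 1 hX (by linarith)
    have z0 : -1 ≤ Real.log |x + y| := by linarith
    obtain ⟨hp, hh⟩ := hH1 |x| (|x| / 2) hX (by linarith) (by linarith) (by linarith) le_rfl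
    have hh2 : Real.log |x| ≤ Real.log (|x| / 2) + 1 := by
      simpa using log_le_pow (u := |x|) (v := |x| / 2) 1 hX (by linarith)
    have ht := omega_log a0 a1 (l := |y|) (n := |x|) hY hX hxy le_rfl (by linarith) (Or.inl le_rfl) hT
    apply exp_form hz (RR_pos x y) (by linarith) hp
    have hr : |(Real.log (RR x y) - Real.log |y|)| ≤ 5 := by
      rw [abs_le] at hR ⊢
      have : |(max (Real.log |x + y|) 0 - Real.log |x|)| ≤ 2 := by
        rw [abs_le]
        rcases max_cases (Real.log |x + y|) 0 with h | h <;> constructor <;> linarith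
      rw [abs_le] at this
      constructor <;> linarith
    have hs := sig_le (σ := σ) hr
    have g1 := mul_le_mul_of_nonneg_left ht b0
    have g2 := mul_le_mul_of_nonneg_left (show α * Real.log |x| + Real.log |x| ≤ Real.log H + 1 by linarith)
      (show 0 ≤ a by linarith)
    have g3 := mul_nonpos_of_nonpos_of_nonneg q1 (sub_nonneg.mpr lyx)
    have g4 := mul_nonpos_of_nonpos_of_nonneg q2 ly0
    linarith
  · have xy : Real.log |x| ≤ Real.log |y| + 1 := by
      simpa using log_le_pow (u := |x|) (v := |y|) 1 hX (by linarith)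
    rcases le_total (2 * |x + y|) |x| with h2 | h2
    · -- high times high to low
      obtain ⟨hp, hh⟩ := hH1 |x| |x + y| hX hz le_rfl (by linarith) le_rfl
      have ht := omega_log a0 a1 (l := |x + y|) (n := |x|) hz hX (by linarith) (by linarith) le_rfl
        (Or.inl le_rfl) hT
      have zx' : Real.log |x + y| ≤ Real.log |x| := Real.log_le_log hz (by linarith)
      apply exp_form hz (RR_pos x y) (by linarith) hp
      have hr : |Real.log (RR x y) - (2 * Real.log |x| - max (Real.log |x + y|) 0)| ≤ 5 := by
        rw [abs_le] at hR ⊢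
        constructor <;> linarith
      have hs := sig_le (σ := σ) hr
      have g1 := mul_le_mul_of_nonneg_left ht b0
      have g2 := mul_le_mul_of_nonneg_left hh (show 0 ≤ a by linarith)
      rcases le_total (Real.log |x + y|) 0 with h3 | h3
      · rw [max_eq_right h3] at hs
        have g3 := mul_nonpos_of_nonpos_of_nonneg q3 lx0
        have g4 := mul_nonpos_of_nonneg_of_nonpos e0.le h3
        linarith
      · rw [max_eq_left h3] at hs
        have g3 := mul_nonpos_of_nonpos_of_nonneg q3 (sub_nonneg.mpr zx')
        have g4 := mul_nonpos_of_nonpos_of_nonneg q4 h3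
        linarith
    · -- all comparable
      have xz : Real.log |x| ≤ Real.log |x + y| + 1 := by
        simpa using log_le_pow (u := |x|) (v := |x + y|) 1 hX (by linarith)
      obtain ⟨hp, hh⟩ := hH2 (by linarith)
      have ht := omega_log a0 a1 (l := |x| / 2) (n := |x|) (by linarith) hX (by linarith) (by linarith)
        (by linarith) (Or.inl le_rfl) hT
      have hh2 : Real.log |x| ≤ Real.log (|x| / 2) + 1 := by
        simpa using log_le_pow (u := |x|) (v := |x| / 2) 1 hX (by linarith)
      apply exp_form hz (RR_pos x y) (by linarith) hp
      have hr : |(Real.log (RR x y) - Real.log |x|)| ≤ 6 := by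
        rw [abs_le] at hR ⊢
        have : |(max (Real.log |x + y|) 0 - Real.log |x|)| ≤ 2 := by
          rw [abs_le]
          rcases max_cases (Real.log |x + y|) 0 with h | h <;> constructor <;> linarith
        rw [abs_le] at this
        constructor <;> linarith
      have hs := sig_le (σ := σ) hr
      have g1 := mul_le_mul_of_nonneg_left (show (2 + α) * Real.log |x| ≤ Real.log T + 5 by linarith) b0
      have g2 := mul_le_mul_of_nonneg_left (show α / 2 * Real.log |x| ≤ Real.log H + 4 by
        have := mul_le_mul_of_nonneg_left xz (show 0 ≤ α / 2 by linarith)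
        linarith)
        (show 0 ≤ a by linarith)
      have g3 := mul_nonpos_of_nonpos_of_nonneg q5 lx0
      linarith

theorem RR_comm (x y : ℝ) : RR x y = RR y x := by
  unfold RR; rw [add_comm x y, mul_comm (jap x)]

theorem PA_high {α a σ ε : ℝ} (C : Cond α a σ ε) {x y T : ℝ} (hx : 1 ≤ |x|) (hy : 1 ≤ |y|)
    (hT1 : 1 ≤ T) (hT : |omegaBO α (x + y) - omegaBO α x - omegaBO α y| ≤ 3 * T) :
    |x + y| * RR x y ^ σ * T ^ (-(1 - a - 2 * ε)) ≤ Real.exp (50 + 50 * |σ|) * HH α (x + y) x ^ a := by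
  have e1 : x + y - x = y := by ring
  have e2 : 2 * x - (x + y) = x - y := by ring
  have H1 : ∀ n l, 0 < n → 0 < l → l ≤ |x + y| → l ≤ |x - y| → (n ≤ |x| ∨ n ≤ |y|) →
      0 < HH α (x + y) x ∧ α * Real.log n + Real.log l ≤ Real.log (HH α (x + y) x) := by
    intro n l hn hl h1 h2 h3
    apply HH_one_log C.a0 _ _ n l hn hl h1 (by rwa [e2]) (by rwa [e1])
  have H2 : 1 / 2 ≤ |x + y| → 0 < HH α (x + y) x ∧
      α / 2 * Real.log |x + y| ≤ Real.log (HH α (x + y) x) + 3 := fun h => HH_two_log C.a0 C.a1 _ _ h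
  have H0 := HH_nonneg C.a0 (x + y) x
  rcases le_total |y| |x| with h | h
  · exact PA_core C h hy hT1 hT H0 (fun n l hn hl h1 h2 h3 => H1 n l hn hl h1 h2 (Or.inl h3)) H2
  · rw [RR_comm]
    generalize HH α (x + y) x = H at *
    rw [add_comm x y] at *
    refine PA_core C h hx hT1 ?_ H0
      (fun n l hn hl h1 h2 h3 => H1 n l hn hl h1 (by rwa [abs_sub_comm]) (Or.inr h3)) H2
    convert hT using 2; ring

theorem PA_low {α a σ ε : ℝ} (C : Cond α a σ ε) {x y : ℝ} (h : |x| ≤ 1 ∨ |y| ≤ 1) :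
    |x + y| * RR x y ^ σ ≤ Real.exp (50 + 50 * |σ|) * HH α (x + y) x ^ a := by
  obtain ⟨a0, a1, ha, ha1, hal, e0, b0, -, -, -, -, -, -, -, -, -, -, -⟩ := C
  have H0 := HH_nonneg a0 (x + y) x
  rcases (abs_nonneg (x + y)).eq_or_lt with hz | hz
  · rw [← hz]; simp; positivity
  have e1 : x + y - x = y := by ring
  have e2 : 2 * x - (x + y) = x - y := by ring
  have t1 : |x + y| ≤ |x| + |y| := abs_add_le x y
  have t2 : |x| - |y| ≤ |x + y| := by
    have := abs_sub_abs_le_abs_sub x (-y)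
    rwa [abs_neg, sub_neg_eq_add] at this
  have t2' : |y| - |x| ≤ |x + y| := by
    have := abs_sub_abs_le_abs_sub y (-x)
    rwa [abs_neg, sub_neg_eq_add, add_comm] at this
  have t3 : |x| - |y| ≤ |x - y| := abs_sub_abs_le_abs_sub x y
  have t3' : |y| - |x| ≤ |x - y| := by rw [abs_sub_comm]; exact abs_sub_abs_le_abs_sub y x
  have hR := log_RR x y
  have hσ := abs_nonneg σ
  suffices hsuf : 0 < HH α (x + y) x ∧
      Real.log |x + y| + σ * Real.log (RR x y) ≤ (50 + 50 * |σ|) + a * Real.log (HH α (x + y) x) by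
    have := exp_form (T := 1) (β := 0) hz (RR_pos x y) one_pos hsuf.1 (by simpa using hsuf.2)
    simpa using this
  have main : ∀ N : ℝ, 4 ≤ N → N / 2 ≤ |x + y| → |x + y| ≤ 2 * N → N / 2 ≤ |x - y| →
      (N ≤ |x| ∨ N ≤ |y|) → max (Real.log |x|) 0 + max (Real.log |y|) 0 = Real.log N →
      0 < HH α (x + y) x ∧
      Real.log |x + y| + σ * Real.log (RR x y) ≤ (50 + 50 * |σ|) + a * Real.log (HH α (x + y) x) := by
    intro N hN h1 h1' h2 h3 h4
    obtain ⟨hp, hh⟩ := HH_one_log a0 (x + y) x N (N / 2) (by linarith) (by linarith) h1 (by rwa [e2]) (by rwa [e1])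
    refine ⟨hp, ?_⟩
    have hh2 : Real.log N ≤ Real.log (N / 2) + 1 := by
      simpa using log_le_pow (u := N) (v := N / 2) 1 (by linarith) (by linarith)
    have hN0 : 0 ≤ Real.log N := Real.log_nonneg (by linarith)
    have nz : Real.log N ≤ Real.log |x + y| + 1 := by
      simpa using log_le_pow (u := N) (v := |x + y|) 1 (by linarith) (by linarith)
    have zn : Real.log |x + y| ≤ Real.log N + 1 := by
      simpa using log_le_pow (u := |x + y|) (v := N) 1 (by linarith) (by linarith)
    have hr : |Real.log (RR x y) - 0| ≤ 5 := by
      rw [h4] at hR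
      rw [abs_le] at hR ⊢
      have : |max (Real.log |x + y|) 0 - Real.log N| ≤ 2 := by
        rw [abs_le]
        rcases max_cases (Real.log |x + y|) 0 with h | h <;> constructor <;> linarith
      rw [abs_le] at this
      constructor <;> linarith
    have hs := sig_le (σ := σ) hr
    have g2 := mul_le_mul_of_nonneg_left (show α * Real.log N + Real.log N ≤ Real.log (HH α (x + y) x) + 1 by linarith)
      (show 0 ≤ a by linarith)
    have g3 := mul_nonneg (sub_nonneg.mpr hal.le) hN0
    linarith
  rcases le_total |x| 4 with hx | hx
  · rcases le_total |y| 4 with hy | hy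
    · have h1 := HH_three a0 (x + y) x hx
      refine ⟨by linarith, ?_⟩
      have h2 := Real.log_nonneg h1
      have bd : ∀ w : ℝ, |w| ≤ 8 → 0 ≤ max (Real.log |w|) 0 ∧ max (Real.log |w|) 0 ≤ 3 := by
        intro w hw
        refine ⟨le_max_right _ _, max_le ?_ (by norm_num)⟩
        rcases (abs_nonneg w).eq_or_lt with h0 | h0
        · rw [← h0]; simp
        · simpa using log_le_pow (u := |w|) (v := 1) 3 h0 (by linarith)
      have b1 := bd x (by linarith)
      have b2 := bd y (by linarith)
      have b3 := bd (x + y) (by linarith)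
      have b4 := le_max_left (Real.log |x + y|) 0
      have hr : |Real.log (RR x y) - 0| ≤ 10 := by
        rw [abs_le] at hR ⊢
        constructor <;> linarith
      have hs := sig_le (σ := σ) hr
      have := mul_nonneg (show 0 ≤ a by linarith) h2
      linarith
    · have hx1 : |x| ≤ 1 := by rcases h with h | h <;> linarith
      apply main |y| hy (by linarith) (by linarith) (by linarith) (Or.inr le_rfl)
      rw [max_eq_right (Real.log_nonpos (abs_nonneg _) hx1), max_eq_left (Real.log_nonneg (by linarith)), zero_add]
  · rcases le_total |y| 1 with hy1 | hy1
    · apply main |x| hx (by linarith) (by linarith) (by linarith) (Or.inl le_rfl)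
      rw [max_eq_right (Real.log_nonpos (abs_nonneg _) hy1), max_eq_left (Real.log_nonneg (by linarith)), add_zero]
    · have : |y| = 1 := by rcases h with h | h <;> linarith
      apply main |x| hx (by linarith) (by linarith) (by linarith) (Or.inl le_rfl)
      rw [this, max_eq_left (Real.log_nonneg (by linarith))]; simp

theorem exp_form2 {Z R T H W σ β a d K : ℝ} (hZ : 0 < Z) (hR : 0 < R) (hT : 0 < T) (hH : 0 < H) (hW : 0 < W)
    (h : Real.log Z + σ * Real.log R - β * Real.log T ≤ K + a * Real.log H - d * Real.log W) :
    Z * R ^ σ * T ^ (-β) ≤ Real.exp K * H ^ a * W ^ (-d) := by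
  rw [Real.rpow_def_of_pos hR, Real.rpow_def_of_pos hT, Real.rpow_def_of_pos hH, Real.rpow_def_of_pos hW]
  nth_rewrite 1 [← Real.exp_log hZ]
  rw [← Real.exp_add, ← Real.exp_add, ← Real.exp_add, ← Real.exp_add]
  apply Real.exp_le_exp.mpr
  linarith

theorem PB_log {α a σ ε : ℝ} (C : Cond α a σ ε) {x y T : ℝ} (hx : 1 ≤ |x|) (hy : 1 ≤ |y|)
    (hz : 0 < |x + y|)
    (hT : |omegaBO α (x + y) - omegaBO α x - omegaBO α y| ≤ 3 * T) :
    0 < HH α x (x + y) ∧ ∃ w, (w = x ∨ w = y) ∧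
      Real.log |x + y| + σ * Real.log (RR x y) - (a - 2 * ε) * Real.log T ≤
       (48 + 50 * |σ|) + (1 - a) * Real.log (HH α x (x + y)) - (1 + ε) * (2 * a - 1) * Real.log |w| := by
  obtain ⟨a0, a1, ha, ha1, hal, e0, b0, q1, -, -, -, -, p1, p2, p3, p4, p5, p6⟩ := C
  have b1 : 0 ≤ a - 2 * ε := by linarith
  have b2 : 0 ≤ 1 - a := by linarith
  have d0 : 0 ≤ (1 + ε) * (2 * a - 1) := mul_nonneg (by linarith) (by linarith)
  have d1 : (1 + ε) * (2 * a - 1) ≤ 2 := by nlinarith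
  have e1 : |x - (x + y)| = |y| := by rw [show x - (x + y) = -y by ring, abs_neg]
  have e2 : 2 * (x + y) - x = x + 2 * y := by ring
  have hX : 0 < |x| := by linarith
  have hY : 0 < |y| := by linarith
  have lx0 := Real.log_nonneg hx
  have ly0 := Real.log_nonneg hy
  have H1 : ∀ n l, 0 < n → 0 < l → l ≤ |x| → l ≤ |x + 2 * y| → (n ≤ |x + y| ∨ n ≤ |y|) →
      0 < HH α x (x + y) ∧ α * Real.log n + Real.log l ≤ Real.log (HH α x (x + y)) := by
    intro n l hn hl h1 h2 h3
    apply HH_one_log a0 _ _ n l hn hl h1 (by rwa [e2]) (by rwa [e1])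
  have H2 := HH_two_log a0 a1 x (x + y) (by linarith)
  generalize HH α x (x + y) = H at *
  have t1 : |x + y| ≤ |x| + |y| := abs_add_le x y
  have t2 : |x| - |y| ≤ |x + y| := by
    have := abs_sub_abs_le_abs_sub x (-y)
    rwa [abs_neg, sub_neg_eq_add] at this
  have t2' : |y| - |x| ≤ |x + y| := by
    have := abs_sub_abs_le_abs_sub y (-x)
    rwa [abs_neg, sub_neg_eq_add, add_comm] at this
  have t3 : |x| - 2 * |y| ≤ |x + 2 * y| := by
    have := abs_sub_abs_le_abs_sub x (-(2 * y))
    rwa [abs_neg, sub_neg_eq_add, abs_mul, abs_two] at this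
  have t4 : 2 * |y| - |x| ≤ |x + 2 * y| := by
    have := abs_sub_abs_le_abs_sub (2 * y) (-x)
    rwa [abs_neg, sub_neg_eq_add, abs_mul, abs_two, add_comm] at this
  have t5 : |y| - |x + y| ≤ |x + 2 * y| := by
    have := abs_sub_abs_le_abs_sub y (-(x + y))
    rwa [abs_neg, sub_neg_eq_add, show y + (x + y) = x + 2 * y by ring] at this
  have hR := log_RR x y
  rw [max_eq_left lx0, max_eq_left ly0] at hR
  have hσ := abs_nonneg σ
  rcases le_total (4 * |y|) |x| with h1 | h1
  · have lyx : Real.log |y| ≤ Real.log |x| := Real.log_le_log hY (by linarith)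
    have xz : Real.log |x| ≤ Real.log |x + y| + 1 := by
      simpa using log_le_pow (u := |x|) (v := |x + y|) 1 hX (by linarith)
    have zx : Real.log |x + y| ≤ Real.log |x| + 1 := by
      simpa using log_le_pow (u := |x + y|) (v := |x|) 1 hz (by linarith)
    obtain ⟨hp, hh⟩ := H1 (|x| / 2) (|x| / 2) (by linarith) (by linarith) (by linarith) (by linarith)
      (Or.inl (by linarith))
    refine ⟨hp, y, Or.inr rfl, ?_⟩
    have hh2 : Real.log |x| ≤ Real.log (|x| / 2) + 1 := by
      simpa using log_le_pow (u := |x|) (v := |x| / 2) 1 hX (by linarith)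
    have hh3 := mul_le_mul_of_nonneg_left hh2 a0.le
    have ht := omega_log a0 a1 (l := |y|) (n := |x|) hY hX (by linarith) le_rfl (by linarith) (Or.inl le_rfl) hT
    have hr : |(Real.log (RR x y) - Real.log |y|)| ≤ 5 := by
      rw [abs_le] at hR ⊢
      have : |(max (Real.log |x + y|) 0 - Real.log |x|)| ≤ 2 := by
        rw [abs_le]
        rcases max_cases (Real.log |x + y|) 0 with h | h <;> constructor <;> linarith
      rw [abs_le] at this
      constructor <;> linarith
    have hs := sig_le (σ := σ) hr
    have g1 := mul_le_mul_of_nonneg_left ht b1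
    have g2 := mul_le_mul_of_nonneg_left (show α * Real.log |x| + Real.log |x| ≤ Real.log H + 2 by linarith) b2
    have g3 := mul_nonpos_of_nonpos_of_nonneg q1 (sub_nonneg.mpr lyx)
    have g4 := mul_nonpos_of_nonpos_of_nonneg p1 ly0
    linarith
  rcases le_total (2 * |x|) |y| with h2 | h2
  · have lxy : Real.log |x| ≤ Real.log |y| := Real.log_le_log hX (by linarith)
    have yz : Real.log |y| ≤ Real.log |x + y| + 1 := by
      simpa using log_le_pow (u := |y|) (v := |x + y|) 1 hY (by linarith)
    have zy : Real.log |x + y| ≤ Real.log |y| + 1 := by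
      simpa using log_le_pow (u := |x + y|) (v := |y|) 1 hz (by linarith)
    obtain ⟨hp, hh⟩ := H1 |y| |x| hY hX le_rfl (by linarith) (Or.inr le_rfl)
    refine ⟨hp, x, Or.inl rfl, ?_⟩
    have ht := omega_log a0 a1 (l := |x|) (n := |y|) hX hY le_rfl (by linarith) (by linarith) (Or.inr le_rfl) hT
    have hr : |(Real.log (RR x y) - Real.log |x|)| ≤ 5 := by
      rw [abs_le] at hR ⊢
      have : |(max (Real.log |x + y|) 0 - Real.log |y|)| ≤ 2 := by
        rw [abs_le]
        rcases max_cases (Real.log |x + y|) 0 with h | h <;> constructor <;> linarith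
      rw [abs_le] at this
      constructor <;> linarith
    have hs := sig_le (σ := σ) hr
    have g1 := mul_le_mul_of_nonneg_left ht b1
    have g2 := mul_le_mul_of_nonneg_left hh b2
    have g3 := mul_nonpos_of_nonpos_of_nonneg p2 (sub_nonneg.mpr lxy)
    have g4 := mul_nonpos_of_nonpos_of_nonneg p3 lx0
    linarith
  have xy : Real.log |x| ≤ Real.log |y| + 2 := by
    simpa using log_le_pow (u := |x|) (v := |y|) 2 hX (by linarith)
  have yx : Real.log |y| ≤ Real.log |x| + 1 := by
    simpa using log_le_pow (u := |y|) (v := |x|) 1 hY (by linarith)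
  rcases le_total (4 * |x + y|) |y| with h3 | h3
  · obtain ⟨hp, hh⟩ := H1 |y| (|y| / 2) hY (by linarith) (by linarith) (by linarith) (Or.inr le_rfl)
    refine ⟨hp, y, Or.inr rfl, ?_⟩
    have hh2 : Real.log |y| ≤ Real.log (|y| / 2) + 1 := by
      simpa using log_le_pow (u := |y|) (v := |y| / 2) 1 hY (by linarith)
    have ht := omega_log a0 a1 (l := |x + y|) (n := |y|) hz hY (by linarith) (by linarith) le_rfl
      (Or.inr le_rfl) hT
    have zy : Real.log |x + y| ≤ Real.log |y| := Real.log_le_log hz (by linarith)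
    have hr : |Real.log (RR x y) - (2 * Real.log |y| - max (Real.log |x + y|) 0)| ≤ 5 := by
      rw [abs_le] at hR ⊢
      constructor <;> linarith
    have hs := sig_le (σ := σ) hr
    have g1 := mul_le_mul_of_nonneg_left ht b1
    have g2 := mul_le_mul_of_nonneg_left (show α * Real.log |y| + Real.log |y| ≤ Real.log H + 1 by linarith) b2
    rcases le_total (Real.log |x + y|) 0 with h4 | h4
    · rw [max_eq_right h4] at hs
      have g3 := mul_nonpos_of_nonpos_of_nonneg p4 ly0
      have g4 := mul_nonpos_of_nonneg_of_nonpos (show 0 ≤ 1 - a + 2 * ε by linarith) h4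
      linarith
    · rw [max_eq_left h4] at hs
      have g3 := mul_nonpos_of_nonpos_of_nonneg p4 (sub_nonneg.mpr zy)
      have g4 := mul_nonpos_of_nonpos_of_nonneg p5 h4
      linarith
  · refine ⟨H2.1, y, Or.inr rfl, ?_⟩
    have yz : Real.log |y| ≤ Real.log |x + y| + 2 := by
      simpa using log_le_pow (u := |y|) (v := |x + y|) 2 hY (by linarith)
    have zy : Real.log |x + y| ≤ Real.log |y| + 3 := by
      simpa using log_le_pow (u := |x + y|) (v := |y|) 3 hz (by linarith)
    have ht := omega_log a0 a1 (l := |y| / 4) (n := |y|) (by linarith) hY (by linarith) (by linarith)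
      (by linarith) (Or.inr le_rfl) hT
    have hh2 : Real.log |y| ≤ Real.log (|y| / 4) + 2 := by
      simpa using log_le_pow (u := |y|) (v := |y| / 4) 2 hY (by linarith)
    have hh := H2.2
    have hr : |(Real.log (RR x y) - Real.log |y|)| ≤ 10 := by
      rw [abs_le] at hR ⊢
      have : |(max (Real.log |x + y|) 0 - Real.log |y|)| ≤ 3 := by
        rw [abs_le]
        rcases max_cases (Real.log |x + y|) 0 with h | h <;> constructor <;> linarith
      rw [abs_le] at this
      constructor <;> linarith
    have hs := sig_le (σ := σ) hr
    have g0 := mul_le_mul_of_nonneg_left yx (show 0 ≤ α / 2 by linarith)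
    have g1 := mul_le_mul_of_nonneg_left (show (2 + α) * Real.log |y| ≤ Real.log T + 6 by linarith) b1
    have g2 := mul_le_mul_of_nonneg_left (show α / 2 * Real.log |y| ≤ Real.log H + 4 by linarith) b2
    have g3 := mul_nonpos_of_nonpos_of_nonneg p6 ly0
    linarith

theorem PB {α a σ ε : ℝ} (C : Cond α a σ ε) {x y T : ℝ} (hx : 1 ≤ |x|) (hy : 1 ≤ |y|)
    (hT1 : 1 ≤ T)
    (hT : |omegaBO α (x + y) - omegaBO α x - omegaBO α y| ≤ 3 * T) :
    |x + y| * RR x y ^ σ * T ^ (-(a - 2 * ε)) ≤ Real.exp (50 + 50 * |σ|) * 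
      ((jap x ^ (-(1 + ε)) + jap y ^ (-(1 + ε))) ^ (2 * a - 1) * HH α x (x + y) ^ (1 - a)) := by
  have nx := Real.rpow_nonneg (jap_pos x).le (-(1 + ε))
  have ny := Real.rpow_nonneg (jap_pos y).le (-(1 + ε))
  have H0 := HH_nonneg C.a0 x (x + y)
  rcases (abs_nonneg (x + y)).eq_or_lt with hz | hz
  · rw [← hz, zero_mul, zero_mul]
    exact mul_nonneg (Real.exp_pos _).le (mul_nonneg (Real.rpow_nonneg (by linarith) _) (Real.rpow_nonneg H0 _))
  obtain ⟨hp, w, hw, hl⟩ := PB_log C hx hy hz hT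
  have e0 := C.e0
  have ha := C.ha
  have d0 : 0 ≤ (1 + ε) * (2 * a - 1) := mul_nonneg (by linarith) (by linarith)
  have d1 : (1 + ε) * (2 * a - 1) ≤ 2 := by nlinarith [C.ha1, C.b0]
  have hw1 : 1 ≤ |w| := by rcases hw with rfl | rfl <;> assumption
  have hj := abs_le.mp (log_jap w)
  rw [max_eq_left (Real.log_nonneg hw1)] at hj
  have hj2 : Real.log (jap w) ≤ Real.log |w| + 1 := by linarith
  have g := mul_le_mul_of_nonneg_left hj2 d0
  have := exp_form2 (K := 50 + 50 * |σ|) (a := 1 - a) (d := (1 + ε) * (2 * a - 1)) (β := a - 2 * ε) (σ := σ)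
    hz (RR_pos x y) (show 0 < T by linarith) hp (jap_pos w) (by linarith)
  refine this.trans ?_
  rw [mul_assoc]
  apply mul_le_mul_of_nonneg_left _ (Real.exp_pos _).le
  rw [mul_comm]
  apply mul_le_mul_of_nonneg_right _ (by positivity)
  rw [show -((1 + ε) * (2 * a - 1)) = (-(1 + ε)) * (2 * a - 1) by ring, Real.rpow_mul (jap_pos w).le]
  apply Real.rpow_le_rpow (Real.rpow_nonneg (jap_pos w).le _) _ (by linarith)
  rcases hw with rfl | rfl <;> linarith

theorem wt_A {a ε : ℝ} (ha1 : a < 1) (e0 : 0 < ε) (s : ℝ) :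
    jap s ^ (-(a + ε)) ≤ (jap s ^ (-(1 + ε))) ^ a := by
  rw [← Real.rpow_mul (jap_pos s).le]
  apply Real.rpow_le_rpow_of_exponent_le (jap_ge_one s)
  nlinarith

theorem wt_B {a ε : ℝ} (ha0 : 0 < a) (_ha1 : a < 1) (e0 : 0 < ε) {s0 s1 : ℝ} (h : |s0| ≤ |s1|) :
    jap s1 ^ (-(a + ε)) * jap s0 ^ (-(1 - a) + 2 * ε) ≤
      jap s1 ^ (-(a - 2 * ε)) * (jap s0 ^ (-(1 + ε))) ^ (1 - a) := by
  rw [← Real.rpow_mul (jap_pos s0).le]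
  have h1 : jap s0 ^ (-(1 - a) + 2 * ε) = jap s0 ^ (-(1 + ε) * (1 - a)) * jap s0 ^ (2 * ε + ε * (1 - a)) := by
    rw [← Real.rpow_add (jap_pos s0)]; congr 1; ring
  have h2 : jap s1 ^ (-(a - 2 * ε)) = jap s1 ^ (-(a + ε)) * jap s1 ^ (3 * ε) := by
    rw [← Real.rpow_add (jap_pos s1)]; congr 1; ring
  rw [h1, h2]
  have h3 : jap s0 ^ (2 * ε + ε * (1 - a)) ≤ jap s1 ^ (3 * ε) := by
    calc jap s0 ^ (2 * ε + ε * (1 - a)) ≤ jap s0 ^ (3 * ε) :=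
          Real.rpow_le_rpow_of_exponent_le (jap_ge_one s0) (by nlinarith)
      _ ≤ _ := Real.rpow_le_rpow (jap_pos s0).le (jap_mono h) (by linarith)
  have n1 := Real.rpow_nonneg (jap_pos s1).le (-(a + ε))
  have n2 := Real.rpow_nonneg (jap_pos s0).le (-(1 + ε) * (1 - a))
  have := mul_le_mul_of_nonneg_left h3 (mul_nonneg n1 n2)
  linarith

noncomputable def UB (ε x y s2 : ℝ) : ℝ := (jap x ^ (-(1 + ε)) + jap y ^ (-(1 + ε))) * jap s2 ^ (-(1 + ε))
noncomputable def VB (α ε c z s0 s2 : ℝ) : ℝ := HH α c z * (jap s0 ^ (-(1 + ε)) * jap s2 ^ (-(1 + ε)))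

theorem jp_nonneg (s e : ℝ) : 0 ≤ jap s ^ e := Real.rpow_nonneg (jap_pos s).le e

theorem UB_nonneg (ε x y s2 : ℝ) : 0 ≤ UB ε x y s2 :=
  mul_nonneg (add_nonneg (jp_nonneg _ _) (jp_nonneg _ _)) (jp_nonneg _ _)

theorem VB_nonneg {α : ℝ} (hα : 0 < α) (ε c z s0 s2 : ℝ) : 0 ≤ VB α ε c z s0 s2 :=
  mul_nonneg (HH_nonneg hα _ _) (mul_nonneg (jp_nonneg _ _) (jp_nonneg _ _))

theorem ker_B {α a σ ε : ℝ} (C : Cond α a σ ε) {x y s0 s1 s2 : ℝ} (hx : 1 ≤ |x|) (hy : 1 ≤ |y|)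
    (h0 : |s0| ≤ |s1|)
    (hT : |omegaBO α (x + y) - omegaBO α x - omegaBO α y| ≤ 3 * |s1|) :
    |x + y| * RR x y ^ σ * jap s0 ^ (-(1 - a) + 2 * ε) * jap s1 ^ (-(a + ε)) * jap s2 ^ (-(a + ε)) ≤
      Real.exp (50 + 50 * |σ|) * (UB ε x y s2 ^ (2 * a - 1) * VB α ε x (x + y) s0 s2 ^ (1 - a)) := by
  have h1 := PB C hx hy (jap_ge_one s1) (hT.trans (by linarith [abs_le_jap s1]))
  have ha := C.ha
  have h2 := wt_B (by linarith) C.ha1 C.e0 h0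
  have h3 := wt_A C.ha1 C.e0 s2
  have nU := add_nonneg (jp_nonneg x (-(1 + ε))) (jp_nonneg y (-(1 + ε)))
  have nH := HH_nonneg C.a0 x (x + y)
  unfold UB VB
  rw [Real.mul_rpow nU (jp_nonneg _ _), Real.mul_rpow nH (mul_nonneg (jp_nonneg _ _) (jp_nonneg _ _)),
    Real.mul_rpow (jp_nonneg _ _) (jp_nonneg _ _)]
  have h4 : (jap s2 ^ (-(1 + ε))) ^ a = (jap s2 ^ (-(1 + ε))) ^ (2 * a - 1) * (jap s2 ^ (-(1 + ε))) ^ (1 - a) := by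
    rw [← Real.rpow_add (Real.rpow_pos_of_pos (jap_pos s2) _)]; congr 1; ring
  rw [h4] at h3
  have nR : 0 ≤ |x + y| * RR x y ^ σ := mul_nonneg (abs_nonneg _) (Real.rpow_nonneg (RR_pos x y).le _)
  have n1 : 0 ≤ (jap s0 ^ (-(1 + ε))) ^ (1 - a) := Real.rpow_nonneg (jp_nonneg _ _) _
  have n2 : 0 ≤ (jap s2 ^ (-(1 + ε))) ^ (1 - a) := Real.rpow_nonneg (jp_nonneg _ _) _
  have n3 : 0 ≤ (jap s2 ^ (-(1 + ε))) ^ (2 * a - 1) := Real.rpow_nonneg (jp_nonneg _ _) _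
  calc _ = (|x + y| * RR x y ^ σ) * (jap s1 ^ (-(a + ε)) * jap s0 ^ (-(1 - a) + 2 * ε)) * jap s2 ^ (-(a + ε)) := by ring
    _ ≤ (|x + y| * RR x y ^ σ) * (jap s1 ^ (-(a - 2 * ε)) * (jap s0 ^ (-(1 + ε))) ^ (1 - a)) *
        ((jap s2 ^ (-(1 + ε))) ^ (2 * a - 1) * (jap s2 ^ (-(1 + ε))) ^ (1 - a)) := by
        apply mul_le_mul (mul_le_mul_of_nonneg_left h2 nR) h3 (jp_nonneg _ _)
        exact mul_nonneg nR (mul_nonneg (jp_nonneg _ _) n1)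
    _ = (|x + y| * RR x y ^ σ * jap s1 ^ (-(a - 2 * ε))) * ((jap s0 ^ (-(1 + ε))) ^ (1 - a) *
        ((jap s2 ^ (-(1 + ε))) ^ (2 * a - 1) * (jap s2 ^ (-(1 + ε))) ^ (1 - a))) := by ring
    _ ≤ _ := mul_le_mul_of_nonneg_right h1 (by positivity)
    _ = _ := by ring

theorem ker_A {α a σ ε : ℝ} (C : Cond α a σ ε) {x y s0 s1 s2 : ℝ} 
    (h : (|x| ≤ 1 ∨ |y| ≤ 1) ∨ 
     (1 ≤ |x| ∧ 1 ≤ |y| ∧ |omegaBO α (x + y) - omegaBO α x - omegaBO α y| ≤ 3 * |s0|)) :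
    |x + y| * RR x y ^ σ * jap s0 ^ (-(1 - a) + 2 * ε) * jap s1 ^ (-(a + ε)) * jap s2 ^ (-(a + ε)) ≤
      Real.exp (50 + 50 * |σ|) * (VB α ε (x + y) x s1 s2 ^ a) := by
  have ha := C.ha
  have nH := HH_nonneg C.a0 (x + y) x
  have nR : 0 ≤ |x + y| * RR x y ^ σ := mul_nonneg (abs_nonneg _) (Real.rpow_nonneg (RR_pos x y).le _)
  have h1 : |x + y| * RR x y ^ σ * jap s0 ^ (-(1 - a) + 2 * ε) ≤
      Real.exp (50 + 50 * |σ|) * HH α (x + y) x ^ a := by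
    rcases h with h | ⟨hx, hy, h⟩
    · have h2 : jap s0 ^ (-(1 - a) + 2 * ε) ≤ 1 :=
        Real.rpow_le_one_of_one_le_of_nonpos (jap_ge_one s0) (by linarith [C.b0])
      exact (mul_le_of_le_one_right nR h2).trans (PA_low C h)
    · have := PA_high C hx hy (jap_ge_one s0) (h.trans (by linarith [abs_le_jap s0]))
      convert this using 3; ring
  unfold VB
  rw [Real.mul_rpow nH (mul_nonneg (jp_nonneg _ _) (jp_nonneg _ _)),
    Real.mul_rpow (jp_nonneg _ _) (jp_nonneg _ _)]
  have h2 := wt_A C.ha1 C.e0 s1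
  have h3 := wt_A C.ha1 C.e0 s2
  have n1 : 0 ≤ (jap s1 ^ (-(1 + ε))) ^ a := Real.rpow_nonneg (jp_nonneg _ _) _
  have n2 : 0 ≤ (jap s2 ^ (-(1 + ε))) ^ a := Real.rpow_nonneg (jp_nonneg _ _) _
  have n3 : 0 ≤ HH α (x + y) x ^ a := by positivity
  calc _ ≤ Real.exp (50 + 50 * |σ|) * HH α (x + y) x ^ a * (jap s1 ^ (-(1 + ε))) ^ a * (jap s2 ^ (-(1 + ε))) ^ a := by
        apply mul_le_mul _ h3 (jp_nonneg _ _) (by positivity)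
        apply mul_le_mul h1 h2 (jp_nonneg _ _) (by positivity)
    _ = _ := by ring

theorem kernel {α a σ ε : ℝ} (C : Cond α a σ ε) {x y s0 s1 s2 : ℝ} 
    (h : s1 + s2 - s0 = omegaBO α (x + y) - omegaBO α x - omegaBO α y) :
    |x + y| * RR x y ^ σ * jap s0 ^ (-(1 - a) + 2 * ε) * jap s1 ^ (-(a + ε)) * jap s2 ^ (-(a + ε)) ≤
      Real.exp (50 + 50 * |σ|) * (VB α ε (x + y) x s1 s2 ^ a +
        UB ε x y s2 ^ (2 * a - 1) * VB α ε x (x + y) s0 s2 ^ (1 - a) +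
        UB ε y x s1 ^ (2 * a - 1) * VB α ε y (x + y) s0 s1 ^ (1 - a)) := by
  have E0 := Real.exp_pos (50 + 50 * |σ|)
  have m1 := mul_nonneg E0.le (Real.rpow_nonneg (VB_nonneg C.a0 ε (x + y) x s1 s2) a)
  have m2 := mul_nonneg E0.le (mul_nonneg (Real.rpow_nonneg (UB_nonneg ε x y s2) (2 * a - 1))
    (Real.rpow_nonneg (VB_nonneg C.a0 ε x (x + y) s0 s2) (1 - a)))
  have m3 := mul_nonneg E0.le (mul_nonneg (Real.rpow_nonneg (UB_nonneg ε y x s1) (2 * a - 1))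
    (Real.rpow_nonneg (VB_nonneg C.a0 ε y (x + y) s0 s1) (1 - a)))
  rw [mul_add, mul_add]
  rcases le_total |x| 1 with hx | hx
  · linarith [ker_A C (s0 := s0) (s1 := s1) (s2 := s2) (x := x) (y := y) (Or.inl (Or.inl hx))]
  rcases le_total |y| 1 with hy | hy
  · linarith [ker_A C (s0 := s0) (s1 := s1) (s2 := s2) (x := x) (y := y) (Or.inl (Or.inr hy))]
  have hO : |omegaBO α (x + y) - omegaBO α x - omegaBO α y| ≤ |s1| + |s2| + |s0| := by
    rw [← h]
    have h1 := abs_sub (s1 + s2) s0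
    have h2 := abs_add_le s1 s2
    linarith
  by_cases hA : |s1| ≤ |s0| ∧ |s2| ≤ |s0|
  · have := ker_A C (s0 := s0) (s1 := s1) (s2 := s2) (x := x) (y := y)
      (Or.inr ⟨hx, hy, by linarith [hA.1, hA.2]⟩)
    linarith
  by_cases hB : |s0| ≤ |s1| ∧ |s2| ≤ |s1|
  · have := ker_B C (s2 := s2) hx hy hB.1 (by linarith [hB.2])
    linarith
  have hD : |s0| ≤ |s2| ∧ |s1| ≤ |s2| := by
    by_contra hD
    rcases le_total |s0| |s1| with h1 | h1 <;> rcases le_total |s0| |s2| with h2 | h2 <;>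
      rcases le_total |s1| |s2| with h3 | h3 <;> simp_all <;> linarith
  have := ker_B C (s2 := s1) (x := y) (y := x) (s0 := s0) (s1 := s2) hy hx hD.1 (by
    rw [add_comm y x, sub_right_comm]; linarith [hD.2])
  rw [RR_comm y x, add_comm y x] at this
  linarith

theorem meas_comp2 {X : Type*} [MeasurableSpace X] {H : ℝ → ℝ → ℝ}
    (h : Measurable (fun z : ℝ × ℝ => H z.1 z.2)) {f g : X → ℝ} (hf : Measurable f) (hg : Measurable g) :
    Measurable (fun p => H (f p) (g p)) := h.comp (hf.prodMk hg)

theorem meas_sec {G : ℝ × ℝ → ℝ × ℝ → ℝ≥0∞}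
    (hG : Measurable (fun p : (ℝ × ℝ) × (ℝ × ℝ) => G p.1 p.2)) (w : ℝ × ℝ) : Measurable (G w) :=
  hG.comp (measurable_const.prodMk measurable_id)

noncomputable def WW (α : ℝ) (q : ℝ × ℝ) : ℝ := q.2 - omegaBO α q.1

theorem WW_meas (α : ℝ) : Measurable (WW α) := by
  unfold WW
  exact measurable_snd.sub ((omega_meas α).comp measurable_fst)

theorem WW_neg (α : ℝ) (q : ℝ × ℝ) : WW α (-q) = - WW α q := by
  unfold WW
  rw [Prod.snd_neg, Prod.fst_neg, omega_neg]; ring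

noncomputable def Phi (α ε : ℝ) (w z : ℝ × ℝ) : ℝ≥0∞ :=
  ENNReal.ofReal (VB α ε w.1 z.1 (WW α z) (WW α (w - z)))

noncomputable def Ups (α ε : ℝ) (q z : ℝ × ℝ) : ℝ≥0∞ :=
  ENNReal.ofReal (UB ε z.1 (q - z).1 (WW α (q - z)))

theorem Phi_meas (α ε : ℝ) : Measurable (fun p : (ℝ × ℝ) × (ℝ × ℝ) => Phi α ε p.1 p.2) := by
  unfold Phi VB
  apply Measurable.ennreal_ofReal
  apply Measurable.mul
  · exact meas_comp2 (HH_meas α) (measurable_fst.comp measurable_fst) (measurable_fst.comp measurable_snd)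
  · apply Measurable.mul
    · exact (jap_meas.comp ((WW_meas α).comp measurable_snd)).pow_const _
    · exact (jap_meas.comp ((WW_meas α).comp (measurable_fst.sub measurable_snd))).pow_const _

theorem Ups_meas (α ε : ℝ) : Measurable (fun p : (ℝ × ℝ) × (ℝ × ℝ) => Ups α ε p.1 p.2) := by
  unfold Ups UB
  apply Measurable.ennreal_ofReal
  apply Measurable.mul
  · apply Measurable.add
    · exact (jap_meas.comp (measurable_fst.comp measurable_snd)).pow_const _
    · exact (jap_meas.comp (measurable_fst.comp (measurable_fst.sub measurable_snd))).pow_const _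
  · exact (jap_meas.comp ((WW_meas α).comp (measurable_fst.sub measurable_snd))).pow_const _

noncomputable def MM (p : ℝ) : ℝ≥0∞ := ENNReal.ofReal (2 ^ p) * (2 * JJ p) * (2 * JJ p + 9)

theorem MM_lt_top {p : ℝ} (hp : 1 < p) : MM p < ⊤ := by
  have := JJ_lt_top hp
  unfold MM
  apply ENNReal.mul_lt_top
  · exact ENNReal.mul_lt_top ENNReal.ofReal_lt_top (ENNReal.mul_lt_top (by norm_num) this)
  · rw [ENNReal.add_lt_top]
    exact ⟨ENNReal.mul_lt_top (by norm_num) this, by norm_num⟩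

theorem Phi_bound {α ε : ℝ} (hα : 0 < α) (he : 0 < ε) (w : ℝ × ℝ) :
    ∫⁻ z, Phi α ε w z ≤ MM (1 + ε) := by
  have hm : Measurable (Phi α ε w) := meas_sec (Phi_meas α ε) w
  rw [Measure.volume_eq_prod, lintegral_prod _ hm.aemeasurable]
  calc _ ≤ ∫⁻ x : ℝ, (ENNReal.ofReal (2 ^ (1 + ε)) * (2 * JJ (1 + ε))) *
        (ENNReal.ofReal (HH α w.1 x) * ENNReal.ofReal (jap (w.2 - psi α w.1 x) ^ (-(1 + ε)))) := by
        apply lintegral_mono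
        intro x
        simp only [Phi, VB, WW, Prod.snd_sub, Prod.fst_sub]
        have e : ∀ t : ℝ, ENNReal.ofReal (HH α w.1 x * (jap (t - omegaBO α x) ^ (-(1 + ε)) *
            jap (w.2 - t - omegaBO α (w.1 - x)) ^ (-(1 + ε)))) =
            ENNReal.ofReal (HH α w.1 x) * (ENNReal.ofReal (jap (t - omegaBO α x) ^ (-(1 + ε))) *
            ENNReal.ofReal (jap ((w.2 - omegaBO α (w.1 - x)) - t) ^ (-(1 + ε)))) := by
          intro t
          rw [ENNReal.ofReal_mul (HH_nonneg hα _ _), ENNReal.ofReal_mul (jp_nonneg _ _), sub_right_comm]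
        simp_rw [e]
        rw [lintegral_const_mul']
        · refine (mul_le_mul_right (conv_tau (by linarith) _ _) _).trans (le_of_eq ?_)
          rw [show w.2 - omegaBO α (w.1 - x) - omegaBO α x = w.2 - psi α w.1 x by unfold psi; ring]
          ring
        · exact ENNReal.ofReal_ne_top
    _ = (ENNReal.ofReal (2 ^ (1 + ε)) * (2 * JJ (1 + ε))) * ∫⁻ x : ℝ, 
        (ENNReal.ofReal (HH α w.1 x) * ENNReal.ofReal (jap (w.2 - psi α w.1 x) ^ (-(1 + ε)))) := by
        apply lintegral_const_mul'
        exact ENNReal.mul_ne_top ENNReal.ofReal_ne_top (ENNReal.mul_ne_top (by norm_num) (JJ_lt_top (by linarith)).ne)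
    _ ≤ _ := by
        unfold MM
        gcongr
        exact phi_bound hα (by linarith) _ _

theorem Ups_bound {α ε : ℝ} (he : 0 < ε) (q : ℝ × ℝ) :
    ∫⁻ z, Ups α ε q z ≤ 2 * JJ (1 + ε) * JJ (1 + ε) := by
  have hm : Measurable (Ups α ε q) := meas_sec (Ups_meas α ε) q
  have hj : Measurable fun x : ℝ => ENNReal.ofReal (jap x ^ (-(1 + ε))) :=
    (jap_meas.pow_const _).ennreal_ofReal
  rw [Measure.volume_eq_prod, lintegral_prod _ hm.aemeasurable]
  calc _ = ∫⁻ x : ℝ, (ENNReal.ofReal (jap x ^ (-(1 + ε))) + ENNReal.ofReal (jap (q.1 - x) ^ (-(1 + ε)))) *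
        JJ (1 + ε) := by
        apply lintegral_congr
        intro x
        simp only [Ups, UB, WW, Prod.snd_sub, Prod.fst_sub]
        have e : ∀ t : ℝ, ENNReal.ofReal ((jap x ^ (-(1 + ε)) + jap (q.1 - x) ^ (-(1 + ε))) *
            jap (q.2 - t - omegaBO α (q.1 - x)) ^ (-(1 + ε))) =
            (ENNReal.ofReal (jap x ^ (-(1 + ε))) + ENNReal.ofReal (jap (q.1 - x) ^ (-(1 + ε)))) *
            ENNReal.ofReal (jap ((q.2 - omegaBO α (q.1 - x)) - t) ^ (-(1 + ε))) := by
          intro t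
          rw [ENNReal.ofReal_mul (add_nonneg (jp_nonneg _ _) (jp_nonneg _ _)),
            ENNReal.ofReal_add (jp_nonneg _ _) (jp_nonneg _ _), sub_right_comm]
        simp_rw [e]
        rw [lintegral_const_mul' _ _ (ENNReal.add_ne_top.mpr ⟨ENNReal.ofReal_ne_top, ENNReal.ofReal_ne_top⟩)]
        congr 1
        exact lintegral_sub_left_eq_self (fun x : ℝ => ENNReal.ofReal (jap x ^ (-(1 + ε)))) _
    _ = (JJ (1 + ε) + JJ (1 + ε)) * JJ (1 + ε) := by
        rw [lintegral_mul_const' _ _ (JJ_lt_top (by linarith)).ne, lintegral_add_left hj]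
        congr 2
        exact lintegral_sub_left_eq_self (fun x : ℝ => ENNReal.ofReal (jap x ^ (-(1 + ε)))) _
    _ ≤ _ := by rw [← two_mul]

noncomputable def nn (r' : ℝ) (F : ℝ × ℝ → ℝ≥0∞) : ℝ≥0∞ := (∫⁻ q, F q ^ r') ^ (1 / r')

theorem conv_int {F1 F2 : ℝ × ℝ → ℝ≥0∞} (h1 : Measurable F1) (h2 : Measurable F2) :
    ∫⁻ q, ∫⁻ z, F1 z * F2 (q - z) = (∫⁻ q, F1 q) * ∫⁻ q, F2 q := by
  have hm : Measurable (fun p : (ℝ × ℝ) × (ℝ × ℝ) => F1 p.2 * F2 (p.1 - p.2)) :=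
    (h1.comp measurable_snd).mul (h2.comp (measurable_fst.sub measurable_snd))
  rw [lintegral_lintegral_swap hm.aemeasurable]
  have : ∀ z, ∫⁻ q, F1 z * F2 (q - z) = F1 z * ∫⁻ q, F2 q := by
    intro z
    have hz : Measurable fun q => F2 (q - z) := h2.comp (measurable_id.sub_const z)
    rw [lintegral_const_mul _ hz]
    congr 1
    exact lintegral_sub_right_eq_self F2 z
  simp_rw [this]
  rw [lintegral_mul_const _ h1]

theorem pow_inv {r' : ℝ} (hr : 0 < r') (x : ℝ≥0∞) : (x ^ r') ^ (1 / r') = x := by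
  rw [← ENNReal.rpow_mul, mul_one_div_cancel hr.ne', ENNReal.rpow_one]

theorem pow_inv' {r' : ℝ} (hr : 0 < r') (x : ℝ≥0∞) : (x ^ (1 / r')) ^ r' = x := by
  rw [← ENNReal.rpow_mul, one_div_mul_cancel hr.ne', ENNReal.rpow_one]

theorem hold_A {a r' : ℝ} (ha : 0 < a) (hr : 0 < r') (har : a + 1 / r' = 1)
    {G : ℝ × ℝ → ℝ × ℝ → ℝ≥0∞} (hG : Measurable (fun p : (ℝ × ℝ) × (ℝ × ℝ) => G p.1 p.2)) {M : ℝ≥0∞}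
    (hM : ∀ q, ∫⁻ z, G q z ≤ M)
    {F1 F2 : ℝ × ℝ → ℝ≥0∞} (h1 : Measurable F1) (h2 : Measurable F2) :
    nn r' (fun q => ∫⁻ z, G q z ^ a * (F1 z * F2 (q - z))) ≤ M ^ a * (nn r' F1 * nn r' F2) := by
  have key : ∀ q, (∫⁻ z, G q z ^ a * (F1 z * F2 (q - z))) ≤
      M ^ a * (∫⁻ z, F1 z ^ r' * F2 (q - z) ^ r') ^ (1 / r') := by
    intro q
    have hm2 : Measurable (fun z => F1 z ^ r' * F2 (q - z) ^ r') :=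
      (h1.pow_const _).mul ((h2.comp (measurable_id.const_sub q)).pow_const _)
    have hGq : Measurable (G q) := hG.comp (measurable_const.prodMk measurable_id)
    have := ENNReal.lintegral_mul_norm_pow_le (μ := volume) hGq.aemeasurable hm2.aemeasurable
      ha.le (show 0 ≤ 1 / r' by positivity) har
    calc _ = ∫⁻ z, G q z ^ a * (F1 z ^ r' * F2 (q - z) ^ r') ^ (1 / r') := by
          apply lintegral_congr; intro z
          rw [ENNReal.mul_rpow_of_nonneg _ _ (by positivity), pow_inv hr, pow_inv hr]
      _ ≤ _ := this
      _ ≤ _ := by gcongr; exact hM q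
  unfold nn
  have h3 : ∫⁻ q, (∫⁻ z, G q z ^ a * (F1 z * F2 (q - z))) ^ r' ≤
      (M ^ a) ^ r' * ((∫⁻ q, F1 q ^ r') * ∫⁻ q, F2 q ^ r') := by
    rw [← conv_int (h1.pow_const _) (h2.pow_const _)]
    have hm : Measurable (fun p : (ℝ × ℝ) × (ℝ × ℝ) => F1 p.2 ^ r' * F2 (p.1 - p.2) ^ r') :=
      ((h1.comp measurable_snd).pow_const _).mul ((h2.comp (measurable_fst.sub measurable_snd)).pow_const _)
    rw [← lintegral_const_mul _ hm.lintegral_prod_right']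
    apply lintegral_mono
    intro q
    refine (ENNReal.rpow_le_rpow (key q) hr.le).trans (le_of_eq ?_)
    rw [ENNReal.mul_rpow_of_nonneg _ _ hr.le, pow_inv' hr]
  refine (ENNReal.rpow_le_rpow h3 (by positivity)).trans (le_of_eq ?_)
  rw [ENNReal.mul_rpow_of_nonneg _ _ (by positivity), ENNReal.mul_rpow_of_nonneg _ _ (by positivity), pow_inv hr]

theorem hold_B {a r' : ℝ} (ha : 1 / 2 < a) (hr : 0 < r') (har : a + 1 / r' = 1)
    {U V : ℝ × ℝ → ℝ × ℝ → ℝ≥0∞} (hU : Measurable (fun p : (ℝ × ℝ) × (ℝ × ℝ) => U p.1 p.2))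
    (hV : Measurable (fun p : (ℝ × ℝ) × (ℝ × ℝ) => V p.1 p.2)) {M N : ℝ≥0∞}
    (hM : ∀ q, ∫⁻ z, U q z ≤ M) (hN : ∀ z, ∫⁻ q, V z q ≤ N)
    {F1 F2 : ℝ × ℝ → ℝ≥0∞} (h1 : Measurable F1) (h2 : Measurable F2) :
    nn r' (fun q => ∫⁻ z, (U q z ^ (2 * a - 1) * V z q ^ (1 - a)) * (F1 z * F2 (q - z))) ≤
      (M ^ (2 * a - 1) * N ^ (1 - a)) * (nn r' F1 * nn r' F2) := by
  have e : 1 - a = 1 / r' := by linarith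
  have hr0 : 0 < 1 / r' := by positivity
  have key : ∀ q, (∫⁻ z, (U q z ^ (2 * a - 1) * V z q ^ (1 - a)) * (F1 z * F2 (q - z))) ≤
      M ^ (2 * a - 1) * ((∫⁻ z, V z q * F1 z ^ r') ^ (1 / r') * (∫⁻ q, F2 q ^ r') ^ (1 / r')) := by
    intro q
    have hUq : Measurable (U q) := hU.comp (measurable_const.prodMk measurable_id)
    have hm1 : Measurable (fun z => V z q * F1 z ^ r') :=
      (hV.comp (measurable_id.prodMk measurable_const)).mul (h1.pow_const _)
    have hm2 : Measurable (fun z => F2 (q - z) ^ r') :=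
      (h2.comp (measurable_id.const_sub q)).pow_const _
    have hm3 : Measurable (fun z => (V z q * F1 z ^ r') ^ ((1:ℝ) / 2) * (F2 (q - z) ^ r') ^ ((1:ℝ) / 2)) :=
      (hm1.pow_const _).mul (hm2.pow_const _)
    have s1 := ENNReal.lintegral_mul_norm_pow_le (μ := volume) hUq.aemeasurable hm3.aemeasurable
      (show 0 ≤ 2 * a - 1 by linarith) (show 0 ≤ 2 * (1 / r') by positivity) (by linarith)
    have s2 := ENNReal.lintegral_mul_norm_pow_le (μ := volume) hm1.aemeasurable hm2.aemeasurable
      (show (0:ℝ) ≤ 1 / 2 by norm_num) (show (0:ℝ) ≤ 1 / 2 by norm_num) (by norm_num)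
    have e2 : ∫⁻ z, F2 (q - z) ^ r' = ∫⁻ q, F2 q ^ r' :=
      lintegral_sub_left_eq_self (fun z => F2 z ^ r') q
    rw [e2] at s2
    have half : ∀ x : ℝ≥0∞, (x ^ ((1:ℝ) / 2)) ^ (2 * (1 / r')) = x ^ (1 / r') := by
      intro x; rw [← ENNReal.rpow_mul]; congr 1; ring
    have n2 : 0 ≤ 2 * (1 / r') := by positivity
    calc _ = ∫⁻ z, U q z ^ (2 * a - 1) *
            ((V z q * F1 z ^ r') ^ ((1:ℝ) / 2) * (F2 (q - z) ^ r') ^ ((1:ℝ) / 2)) ^ (2 * (1 / r')) := by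
          apply lintegral_congr; intro z
          rw [ENNReal.mul_rpow_of_nonneg _ _ n2, half, half,
            ENNReal.mul_rpow_of_nonneg _ _ hr0.le, pow_inv hr, pow_inv hr, e]
          ring
      _ ≤ _ := s1
      _ ≤ M ^ (2 * a - 1) * ((∫⁻ z, V z q * F1 z ^ r') ^ ((1:ℝ) / 2) * (∫⁻ q, F2 q ^ r') ^ ((1:ℝ) / 2)) ^ (2 * (1 / r')) := by
          apply mul_le_mul'
          · exact ENNReal.rpow_le_rpow (hM q) (by linarith)
          · exact ENNReal.rpow_le_rpow s2 n2
      _ = _ := by rw [ENNReal.mul_rpow_of_nonneg _ _ n2, half, half]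
  unfold nn
  have h3 : ∫⁻ q, (∫⁻ z, (U q z ^ (2 * a - 1) * V z q ^ (1 - a)) * (F1 z * F2 (q - z))) ^ r' ≤
      (M ^ (2 * a - 1)) ^ r' * ((N * ∫⁻ q, F1 q ^ r') * ∫⁻ q, F2 q ^ r') := by
    have hm : Measurable (fun p : (ℝ × ℝ) × (ℝ × ℝ) => V p.2 p.1 * F1 p.2 ^ r') :=
      (hV.comp measurable_swap).mul ((h1.comp measurable_snd).pow_const _)
    calc _ ≤ ∫⁻ q, (M ^ (2 * a - 1)) ^ r' * ((∫⁻ z, V z q * F1 z ^ r') * (∫⁻ q, F2 q ^ r')) := by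
          apply lintegral_mono
          intro q
          refine (ENNReal.rpow_le_rpow (key q) hr.le).trans (le_of_eq ?_)
          rw [ENNReal.mul_rpow_of_nonneg _ _ hr.le, ENNReal.mul_rpow_of_nonneg _ _ hr.le, pow_inv' hr, pow_inv' hr]
      _ = (M ^ (2 * a - 1)) ^ r' * ((∫⁻ q, ∫⁻ z, V z q * F1 z ^ r') * (∫⁻ q, F2 q ^ r')) := by
          rw [lintegral_const_mul _ (hm.lintegral_prod_right'.mul_const _), lintegral_mul_const _ hm.lintegral_prod_right']
      _ ≤ _ := by
          gcongr
          rw [lintegral_lintegral_swap hm.aemeasurable]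
          calc _ = ∫⁻ z, (∫⁻ q, V z q) * F1 z ^ r' := by
                apply lintegral_congr; intro z
                rw [lintegral_mul_const]
                exact hV.comp (measurable_const.prodMk measurable_id)
            _ ≤ ∫⁻ z, N * F1 z ^ r' := by
                apply lintegral_mono; intro z
                exact mul_le_mul_left (hN z) _
            _ = _ := lintegral_const_mul _ (h1.pow_const _)
  refine (ENNReal.rpow_le_rpow h3 hr0.le).trans (le_of_eq ?_)
  rw [ENNReal.mul_rpow_of_nonneg _ _ hr0.le, ENNReal.mul_rpow_of_nonneg _ _ hr0.le,
    ENNReal.mul_rpow_of_nonneg _ _ hr0.le, pow_inv hr, e]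
  ring

theorem Phi_eq2 (α ε : ℝ) (q z : ℝ × ℝ) :
    Phi α ε z q = ENNReal.ofReal (VB α ε z.1 q.1 (WW α q) (WW α (q - z))) := by
  unfold Phi VB
  rw [← neg_sub q z, WW_neg, jap_neg]

noncomputable def KB (α a ε : ℝ) (q z : ℝ × ℝ) : ℝ≥0∞ :=
  Phi α ε q z ^ a + Ups α ε q z ^ (2 * a - 1) * Phi α ε z q ^ (1 - a) +
    Ups α ε q (q - z) ^ (2 * a - 1) * Phi α ε (q - z) q ^ (1 - a)

theorem kern_enn {α a σ ε : ℝ} (C : Cond α a σ ε) (q z : ℝ × ℝ) :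
    ENNReal.ofReal (|q.1| * RR z.1 (q - z).1 ^ σ * jap (WW α q) ^ (-(1 - a) + 2 * ε) *
      jap (WW α z) ^ (-(a + ε)) * jap (WW α (q - z)) ^ (-(a + ε))) ≤
    ENNReal.ofReal (Real.exp (50 + 50 * |σ|)) * KB α a ε q z := by
  have hxy : z.1 + (q - z).1 = q.1 := by rw [Prod.fst_sub]; ring
  have h : WW α z + WW α (q - z) - WW α q =
      omegaBO α (z.1 + (q - z).1) - omegaBO α z.1 - omegaBO α (q - z).1 := by
    rw [hxy]; unfold WW; rw [Prod.snd_sub]; ring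
  have k := kernel C h
  rw [hxy] at k
  refine (ENNReal.ofReal_le_ofReal k).trans (le_of_eq ?_)
  have ha := C.ha
  have ha1 := C.ha1
  have v := fun c x s0 s2 => VB_nonneg (ε := ε) C.a0 c x s0 s2
  have u := fun x y s2 => UB_nonneg ε x y s2
  rw [ENNReal.ofReal_mul (Real.exp_pos _).le]
  congr 1
  have p1 := Real.rpow_nonneg (v q.1 z.1 (WW α z) (WW α (q - z))) a
  have p2 := Real.rpow_nonneg (u z.1 (q - z).1 (WW α (q - z))) (2 * a - 1)
  have p3 := Real.rpow_nonneg (v z.1 q.1 (WW α q) (WW α (q - z))) (1 - a)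
  have p4 := Real.rpow_nonneg (u (q - z).1 z.1 (WW α z)) (2 * a - 1)
  have p5 := Real.rpow_nonneg (v (q - z).1 q.1 (WW α q) (WW α z)) (1 - a)
  unfold KB
  rw [Phi_eq2 α ε q z, Phi_eq2 α ε q (q - z)]
  unfold Ups
  unfold Phi
  simp only [_root_.sub_sub_cancel]
  rw [ENNReal.ofReal_add (add_nonneg p1 (mul_nonneg p2 p3)) (mul_nonneg p4 p5),
    ENNReal.ofReal_add p1 (mul_nonneg p2 p3), ENNReal.ofReal_mul p2, ENNReal.ofReal_mul p4,
    ENNReal.ofReal_rpow_of_nonneg (v _ _ _ _) (by linarith),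
    ENNReal.ofReal_rpow_of_nonneg (v _ _ _ _) (by linarith),
    ENNReal.ofReal_rpow_of_nonneg (v _ _ _ _) (by linarith),
    ENNReal.ofReal_rpow_of_nonneg (u _ _ _) (by linarith),
    ENNReal.ofReal_rpow_of_nonneg (u _ _ _) (by linarith)]

noncomputable def FF (α s b : ℝ) (u : ℝ × ℝ → ℂ) (q : ℝ × ℝ) : ℝ≥0∞ :=
  ENNReal.ofReal (jap q.1 ^ s * jap (WW α q) ^ b) * ‖ft2 u q.1 q.2‖ₑ

theorem FF_meas (α s b : ℝ) (u : SchwartzMap (ℝ × ℝ) ℂ) : Measurable (FF α s b u) := by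
  unfold FF
  have h1 : Measurable (fun q : ℝ × ℝ => jap q.1 ^ s * jap (WW α q) ^ b) :=
    ((jap_meas.comp measurable_fst).pow_const _).mul ((jap_meas.comp (WW_meas α)).pow_const _)
  exact h1.ennreal_ofReal.mul (ft2_meas u).enorm

theorem Xnorm_eq (α s b : ℝ) {r' : ℝ} (hr : 0 < r') (u : ℝ × ℝ → ℂ) :
    Xnorm α s b (ENNReal.ofReal r') u = nn r' (FF α s b u) := by
  unfold Xnorm nn
  rw [eLpNorm_eq_lintegral_rpow_enorm_toReal (by simpa using hr) ENNReal.ofReal_ne_top,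
    ENNReal.toReal_ofReal hr.le]
  congr 1
  apply lintegral_congr
  intro q
  congr 1
  unfold FF WW
  rw [enorm_mul, enorm_norm, Real.enorm_of_nonneg]
  exact mul_nonneg (jp_nonneg _ _) (jp_nonneg _ _)

theorem weight_id {X Y Z A B D s a b ε : ℝ} (hX : 0 < X) (hY : 0 < Y) (hZ : 0 < Z) (hA : 0 < A)
    (hB : 0 < B) (t : ℝ) :
    t * (Z ^ s * D ^ b) = (t * (X * Y / Z) ^ (-s) * D ^ b * A ^ (-(a + ε)) * B ^ (-(a + ε))) *
      ((X ^ s * A ^ (a + ε)) * (Y ^ s * B ^ (a + ε))) := by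
  rw [Real.div_rpow (mul_pos hX hY).le hZ.le, Real.mul_rpow hX.le hY.le, Real.rpow_neg hX.le,
    Real.rpow_neg hY.le, Real.rpow_neg hZ.le, Real.rpow_neg hA.le, Real.rpow_neg hB.le]
  have := Real.rpow_pos_of_pos hX s
  have := Real.rpow_pos_of_pos hY s
  have := Real.rpow_pos_of_pos hZ s
  have := Real.rpow_pos_of_pos hA (a + ε)
  have := Real.rpow_pos_of_pos hB (a + ε)
  field_simp

theorem point_bound {α a s ε : ℝ} (C : Cond α a (-s) ε) (u v : SchwartzMap (ℝ × ℝ) ℂ) (q : ℝ × ℝ) :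
    FF α s (-(1 - a) + 2 * ε) (fun p => deriv (fun x => u (p.1, x) * v (p.1, x)) p.2) q ≤
    ENNReal.ofReal (Real.exp (50 + 50 * |(-s)|)) *
      ∫⁻ z, KB α a ε q z * (FF α s (a + ε) u z * FF α s (a + ε) v (q - z)) := by
  unfold FF
  refine (mul_le_mul_right (ft2_main u v q.1 q.2) _).trans ?_
  rw [← mul_assoc, ← ENNReal.ofReal_mul (mul_nonneg (jp_nonneg _ _) (jp_nonneg _ _)),
    ← lintegral_const_mul' _ _ ENNReal.ofReal_ne_top, ← lintegral_const_mul' _ _ ENNReal.ofReal_ne_top]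
  apply lintegral_mono
  intro z
  beta_reduce
  have hxy : z.1 + (q - z).1 = q.1 := by rw [Prod.fst_sub]; ring
  have k := kern_enn C q z
  have w := weight_id (s := s) (a := a) (ε := ε) (D := jap (WW α q)) (b := -(1 - a) + 2 * ε)
    (jap_pos z.1) (jap_pos (q - z).1) (jap_pos q.1)
    (jap_pos (WW α z)) (jap_pos (WW α (q - z))) |q.1|
  rw [mul_comm (jap q.1 ^ s * jap (WW α q) ^ (-(1 - a) + 2 * ε)), w]
  have hRR : RR z.1 (q - z).1 = jap z.1 * jap (q - z).1 / jap q.1 := by unfold RR; rw [hxy]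
  rw [hRR] at k
  have n1 : 0 ≤ jap z.1 ^ s * jap (WW α z) ^ (a + ε) := mul_nonneg (jp_nonneg _ _) (jp_nonneg _ _)
  have n2 : 0 ≤ jap (q - z).1 ^ s * jap (WW α (q - z)) ^ (a + ε) := mul_nonneg (jp_nonneg _ _) (jp_nonneg _ _)
  rw [ENNReal.ofReal_mul' (mul_nonneg n1 n2), ENNReal.ofReal_mul n1]
  rw [← Prod.fst_sub, ← Prod.snd_sub]
  generalize ENNReal.ofReal (jap z.1 ^ s * jap (WW α z) ^ (a + ε)) = A1
  generalize ENNReal.ofReal (jap (q - z).1 ^ s * jap (WW α (q - z)) ^ (a + ε)) = A2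
  generalize ‖ft2 u z.1 z.2‖ₑ = A3
  generalize ‖ft2 v (q - z).1 (q - z).2‖ₑ = A4
  refine le_trans (le_of_eq ?_) ((mul_le_mul_left k (A1 * A3 * (A2 * A4))).trans (le_of_eq ?_))
  · ring
  · ring

theorem nn_add {r' : ℝ} (hr : 1 ≤ r') {f g : ℝ × ℝ → ℝ≥0∞} (hf : Measurable f) (hg : Measurable g) :
    nn r' (fun q => f q + g q) ≤ nn r' f + nn r' g :=
  ENNReal.lintegral_Lp_add_le hf.aemeasurable hg.aemeasurable hr

theorem nn_mono {r' : ℝ} (hr : 0 < r') {f g : ℝ × ℝ → ℝ≥0∞} (h : ∀ q, f q ≤ g q) :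
    nn r' f ≤ nn r' g := by
  unfold nn
  apply ENNReal.rpow_le_rpow _ (by positivity)
  apply lintegral_mono
  intro q
  exact ENNReal.rpow_le_rpow (h q) hr.le

theorem nn_const {r' : ℝ} (hr : 0 < r') {c : ℝ≥0∞} (hc : c ≠ ⊤) (f : ℝ × ℝ → ℝ≥0∞) :
    nn r' (fun q => c * f q) = c * nn r' f := by
  unfold nn
  simp_rw [ENNReal.mul_rpow_of_nonneg _ _ hr.le]
  rw [lintegral_const_mul' _ _ (ENNReal.rpow_ne_top_of_nonneg hr.le hc),
    ENNReal.mul_rpow_of_nonneg _ _ (by positivity), pow_inv hr]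

theorem total_gen {a r' : ℝ} {P U : ℝ × ℝ → ℝ × ℝ → ℝ≥0∞} {M N : ℝ≥0∞}
    (hP : Measurable (fun p : (ℝ × ℝ) × (ℝ × ℝ) => P p.1 p.2))
    (hU : Measurable (fun p : (ℝ × ℝ) × (ℝ × ℝ) => U p.1 p.2))
    (bP : ∀ w, ∫⁻ z, P w z ≤ M) (bU : ∀ w, ∫⁻ z, U w z ≤ N)
    (ha : 1 / 2 < a) (hr : 1 < r') (har : a + 1 / r' = 1)
    {F1 F2 : ℝ × ℝ → ℝ≥0∞} (h1 : Measurable F1) (h2 : Measurable F2) :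
    nn r' (fun q => ∫⁻ z, (P q z ^ a + U q z ^ (2 * a - 1) * P z q ^ (1 - a) +
      U q (q - z) ^ (2 * a - 1) * P (q - z) q ^ (1 - a)) * (F1 z * F2 (q - z))) ≤
      (M ^ a + 2 * (N ^ (2 * a - 1) * M ^ (1 - a))) *
        (nn r' F1 * nn r' F2) := by
  have hr0 : 0 < r' := by linarith
  have A := hold_A (by linarith) hr0 har hP bP h1 h2
  have B := hold_B ha hr0 har hU hP bU bP h1 h2
  have D := hold_B ha hr0 har hU hP bU bP h2 h1
  have mF : ∀ {G1 G2 : ℝ × ℝ → ℝ≥0∞}, Measurable G1 → Measurable G2 →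
      Measurable (fun p : (ℝ × ℝ) × (ℝ × ℝ) => G1 p.2 * G2 (p.1 - p.2)) := fun g1 g2 =>
    (g1.comp measurable_snd).mul (g2.comp (measurable_fst.sub measurable_snd))
  have mA : Measurable (fun p : (ℝ × ℝ) × (ℝ × ℝ) => P p.1 p.2 ^ a * (F1 p.2 * F2 (p.1 - p.2))) :=
    (hP.pow_const _).mul (mF h1 h2)
  have mS : Measurable (fun p : (ℝ × ℝ) × (ℝ × ℝ) => P p.2 p.1) := 
    hP.comp measurable_swap
  have mB : ∀ {G1 G2 : ℝ × ℝ → ℝ≥0∞}, Measurable G1 → Measurable G2 →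
      Measurable (fun p : (ℝ × ℝ) × (ℝ × ℝ) => (U p.1 p.2 ^ (2 * a - 1) * P p.2 p.1 ^ (1 - a)) *
        (G1 p.2 * G2 (p.1 - p.2))) := fun g1 g2 =>
    ((hU.pow_const _).mul (mS.pow_const _)).mul (mF g1 g2)
  have iA := mA.lintegral_prod_right' (ν := volume)
  have iB := (mB h1 h2).lintegral_prod_right' (ν := volume)
  have iD := (mB h2 h1).lintegral_prod_right' (ν := volume)
  have split : ∀ q, ∫⁻ z, (P q z ^ a + U q z ^ (2 * a - 1) * P z q ^ (1 - a) +
      U q (q - z) ^ (2 * a - 1) * P (q - z) q ^ (1 - a)) * (F1 z * F2 (q - z)) ≤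
      ((∫⁻ z, P q z ^ a * (F1 z * F2 (q - z))) +
      ∫⁻ z, (U q z ^ (2 * a - 1) * P z q ^ (1 - a)) * (F1 z * F2 (q - z))) +
      ∫⁻ z, (U q z ^ (2 * a - 1) * P z q ^ (1 - a)) * (F2 z * F1 (q - z)) := by
    intro q
    have sA := meas_sec (G := fun q z => P q z ^ a * (F1 z * F2 (q - z))) mA q
    have sB := meas_sec (G := fun q z => (U q z ^ (2 * a - 1) * P z q ^ (1 - a)) *
      (F1 z * F2 (q - z))) (mB h1 h2) q
    have sAB : Measurable (fun z => P q z ^ a * (F1 z * F2 (q - z)) +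
      (U q z ^ (2 * a - 1) * P z q ^ (1 - a)) * (F1 z * F2 (q - z))) := sA.add sB
    rw [← lintegral_sub_left_eq_self (fun z => (U q z ^ (2 * a - 1) * P z q ^ (1 - a)) *
      (F2 z * F1 (q - z))) q, ← lintegral_add_left sA, ← lintegral_add_left sAB]
    apply lintegral_mono
    intro z
    simp only [_root_.sub_sub_cancel]
    apply le_of_eq
    ring
  refine (nn_mono hr0 split).trans ?_
  refine (nn_add hr.le (iA.add iB) iD).trans ?_
  refine (add_le_add (nn_add hr.le iA iB) le_rfl).trans ?_
  refine (add_le_add (add_le_add A B) D).trans (le_of_eq ?_)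
  ring

theorem total_bound {α a s ε r' : ℝ} (C : Cond α a (-s) ε) (hr : 1 < r') (har : a + 1 / r' = 1)
    {F1 F2 : ℝ × ℝ → ℝ≥0∞} (h1 : Measurable F1) (h2 : Measurable F2) :
    nn r' (fun q => ∫⁻ z, KB α a ε q z * (F1 z * F2 (q - z))) ≤
      (MM (1 + ε) ^ a + 2 * ((2 * JJ (1 + ε) * JJ (1 + ε)) ^ (2 * a - 1) * MM (1 + ε) ^ (1 - a))) *
        (nn r' F1 * nn r' F2) := by
  unfold KB
  exact total_gen (Phi_meas α ε) (Ups_meas α ε) (Phi_bound C.a0 C.e0) (Ups_bound C.e0) C.ha hr har h1 h2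

/-- Key bilinear estimate for the nonlinearity ∂ₓ(u₁u₂), which yields local
well-posedness of the dispersion generalized Benjamin–Ono equation in Ĥ^s_r(ℝ)
by Picard iteration. -/
theorem stmt13 (α : ℝ) (hα0 : 0 < α) (hα1 : α ≤ 1)
    (r r' : ℝ) (hr1 : 1 < r) (hr2 : r < 1 + α) (hconj : 1 / r + 1 / r' = 1)
    (s : ℝ) (hs : -1 - α + 2 / r + α / (2 * r) < s) :
    ∃ ε > (0 : ℝ), ∃ C > (0 : ℝ), ∀ u₁ u₂ : SchwartzMap (ℝ × ℝ) ℂ,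
      Xnorm α s (-(1 / r') + 2 * ε) (ENNReal.ofReal r')
          (fun p : ℝ × ℝ => deriv (fun x : ℝ => u₁ (p.1, x) * u₂ (p.1, x)) p.2) ≤
        ENNReal.ofReal C *
          (Xnorm α s (1 / r + ε) (ENNReal.ofReal r') (⇑u₁) *
            Xnorm α s (1 / r + ε) (ENNReal.ofReal r') (⇑u₂)) := by
  have hr0 : 0 < r := by linarith
  have hlt : 1 / r < 1 := by rw [div_lt_one hr0]; exact hr1
  have hp : 0 < 1 / r' := by linarith
  have hr'0 : 0 < r' := by simpa using hp
  have h1r : 0 < 1 / r := by positivity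
  have hr'1 : 1 < r' := by
    have : 1 / r' < 1 := by linarith
    rwa [div_lt_one hr'0] at this
  have hb : 1 < 1 / r * (1 + α) := by
    rw [one_div_mul_eq_div, one_lt_div hr0]; exact hr2
  have hs' : -s < 1 + α - (2 + α / 2) * (1 / r) := by
    have : (2 + α / 2) * (1 / r) = 2 / r + α / (2 * r) := by field_simp
    linarith
  obtain ⟨ε, C⟩ := exists_cond hα0 hα1 hlt hb hs'
  have he := C.e0
  have ha := C.ha
  set K : ℝ≥0∞ := ENNReal.ofReal (Real.exp (50 + 50 * |(-s)|)) * (MM (1 + ε) ^ (1 / r) +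
    2 * ((2 * JJ (1 + ε) * JJ (1 + ε)) ^ (2 * (1 / r) - 1) * MM (1 + ε) ^ (1 - 1 / r))) with hK
  have hM : MM (1 + ε) ≠ ⊤ := (MM_lt_top (by linarith)).ne
  have hJ : JJ (1 + ε) ≠ ⊤ := (JJ_lt_top (by linarith)).ne
  have hKt : K ≠ ⊤ := by
    rw [hK]
    refine ENNReal.mul_ne_top ENNReal.ofReal_ne_top (ENNReal.add_ne_top.mpr ⟨?_, ?_⟩)
    · exact ENNReal.rpow_ne_top_of_nonneg h1r.le hM
    · refine ENNReal.mul_ne_top (by norm_num) (ENNReal.mul_ne_top ?_ ?_)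
      · exact ENNReal.rpow_ne_top_of_nonneg (by linarith)
          (ENNReal.mul_ne_top (ENNReal.mul_ne_top (by norm_num) hJ) hJ)
      · exact ENNReal.rpow_ne_top_of_nonneg (by linarith) hM
  refine ⟨ε, he, K.toReal + 1, by positivity, ?_⟩
  intro u₁ u₂
  rw [Xnorm_eq _ _ _ hr'0, Xnorm_eq _ _ _ hr'0, Xnorm_eq _ _ _ hr'0]
  have e : -(1 / r') + 2 * ε = -(1 - 1 / r) + 2 * ε := by linarith
  rw [e]
  refine (nn_mono hr'0 (point_bound C u₁ u₂)).trans ?_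
  rw [nn_const hr'0 ENNReal.ofReal_ne_top]
  refine (mul_le_mul_right (total_bound C hr'1 hconj (FF_meas _ _ _ _) (FF_meas _ _ _ _)) _).trans ?_
  rw [← mul_assoc, ← hK]
  refine mul_le_mul_left ?_ _
  calc K = ENNReal.ofReal K.toReal := (ENNReal.ofReal_toReal hKt).symm
    _ ≤ _ := ENNReal.ofReal_le_ofReal (by linarith)
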